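/- Boundedness of the scattering map, single-mode version (Theorems 1.1 and 4.6 of the paper): for every even integer n ≥ 4 there exists a constant C > 0, depending only on n, such that for every λ ≥ 0 the following holds. Let φ : D → ℝ be smooth, self-similar, and satisfy the mode-λ double-null wave equation on D = {(u,v) ∈ ℝ² : u < 0, v > 0}. Define ψ(v) := φ(−1, v) for v > 0 and ψ̲(v) := φ(−v, 1) for v > 0 (both satisfy the mode-λ self-similar wave ODE). Suppose ψ has asymptotic data (φ₀, O, h) and ψ̲ has asymptotic data (φ̲₀, O̲, h̲) at v = 0 in the mode-λ sense. Then, setting 𝔥 := h − O·log√(1+λ²) and 𝔥̲ := h̲ − O̲·log√(1+λ²) (the single-mode version of the renormalization 𝔥 = h − (log∇)O), one has: 𝔥̲² + (1+λ²)ⁿ·φ̲₀² ≤ C·( 𝔥² + (1+λ²)ⁿ·φ₀² ). -/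

import Mathlib

open Set Filter

/-- `ψ` solves the mode-`lam` self-similar wave ODE on `(0,∞)`:
`v(v+1)²·ψ'' + (1 − n/2)·(v+1)²·ψ' + n·v·(v+1)·ψ' + λ²·ψ = 0`. -/
def SolvesWaveODE (n : ℕ) (lam : ℝ) (ψ : ℝ → ℝ) : Prop :=
  ∀ v > (0:ℝ),
    v * (v + 1) ^ 2 * iteratedDeriv 2 ψ v
      + (1 - (n : ℝ) / 2) * (v + 1) ^ 2 * deriv ψ v
      + (n : ℝ) * v * (v + 1) * deriv ψ v
      + lam ^ 2 * ψ v = 0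

/-- `ψ : [0,∞) → ℝ` has asymptotic data `(φ₀, O, h)` at `v = 0` in the mode-`lam`
sense: `ψ` is continuous on `[0,∞)`, smooth on `(0,∞)`, solves the mode-`lam`
self-similar wave ODE on `(0,∞)`, its derivatives `ψ⁽ᵃ⁾` extend continuously to
`v = 0` for `0 ≤ a ≤ n/2 − 1`, `ψ(0) = φ₀`, and `ψ⁽ⁿᐟ²⁾(v) = (1/2)·O·log v + h
+ O(v·(1 + (log v)²))`, `v·ψ⁽ⁿᐟ²⁺¹⁾(v) = O/2 + O(v·(1 + (log v)²))` on `(0,1]`. -/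
def HasAsymptoticDataODE (n : ℕ) (lam : ℝ) (ψ : ℝ → ℝ) (φ₀ O h : ℝ) : Prop :=
  ContinuousOn ψ (Ici 0) ∧ ContDiffOn ℝ (⊤ : ℕ∞) ψ (Ioi 0) ∧ SolvesWaveODE n lam ψ ∧
  (∀ a ≤ n / 2 - 1, ∃ L : ℝ,
    Tendsto (iteratedDeriv a ψ) (nhdsWithin 0 (Ioi 0)) (nhds L)) ∧
  ψ 0 = φ₀ ∧
  ∃ K : ℝ, 0 ≤ K ∧ ∀ v ∈ Ioc (0:ℝ) 1,
    |iteratedDeriv (n / 2) ψ v - (1 / 2) * O * Real.log v - h|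
        ≤ K * v * (1 + Real.log v ^ 2) ∧
    |v * iteratedDeriv (n / 2 + 1) ψ v - O / 2| ≤ K * v * (1 + Real.log v ^ 2)

/-- `φ` is self-similar on `D = {u < 0, v > 0}`. -/
def SelfSimilar (φ : ℝ → ℝ → ℝ) : Prop :=
  ∀ s > (0:ℝ), ∀ u < (0:ℝ), ∀ v > (0:ℝ), φ (s * u) (s * v) = φ u v

/-- `φ` solves the mode-`lam` double-null wave equation on `D = {u < 0, v > 0}`. -/
def SolvesDNWave (n : ℕ) (lam : ℝ) (φ : ℝ → ℝ → ℝ) : Prop :=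
  ∀ u < (0:ℝ), ∀ v > (0:ℝ),
    deriv (fun u' => deriv (fun v' => φ u' v') v) u
      - ((n : ℝ) / 2) / (v - u) * deriv (fun v' => φ u v') v
      + ((n : ℝ) / 2) / (v - u) * deriv (fun u' => φ u' v) u
      + lam ^ 2 / (v - u) ^ 2 * φ u v = 0

/-- `(f, g)` solves the first-order system `f' = g`, `g' = -Λ sech² f` on `ℝ`. -/
structure SechSystem (Λ : ℝ) (f g : ℝ → ℝ) : Prop where
  hasDerivAt_fst : ∀ τ, HasDerivAt f (g τ) τ
  hasDerivAt_snd : ∀ τ, HasDerivAt g (-(Λ / Real.cosh τ ^ 2 * f τ)) τ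

lemma SechSystem.reflect {Λ : ℝ} {f g : ℝ → ℝ} (h : SechSystem Λ f g) :
    SechSystem Λ (fun τ => f (-τ)) (fun τ => -g (-τ)) where
  hasDerivAt_fst τ := by
    have := (h.hasDerivAt_fst (-τ)).scomp τ (hasDerivAt_neg τ)
    simpa [Function.comp_def] using this
  hasDerivAt_snd τ := by
    have := ((h.hasDerivAt_snd (-τ)).scomp τ (hasDerivAt_neg τ)).fun_neg
    simpa [Function.comp_def] using this

lemma one_add_sq_mul_exp_le {σ : ℝ} (hσ : σ ≤ 0) :
    (1 + σ ^ 2) * Real.exp σ ≤ 2 := by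
  have h : (1 + σ ^ 2) / 2 ≤ Real.exp (-σ) := by
    have := Real.quadratic_le_exp_of_nonneg (neg_nonneg.2 hσ)
    nlinarith
  have h1 : Real.exp (-σ) * Real.exp σ = 1 := by rw [← Real.exp_add]; simp
  nlinarith [Real.exp_pos σ, mul_le_mul_of_nonneg_right h (Real.exp_pos σ).le]

lemma inv_cosh_sq_le (τ : ℝ) : 1 / Real.cosh τ ^ 2 ≤ 4 * Real.exp (2 * τ) := by
  have h1 : Real.exp (-τ) / 2 ≤ Real.cosh τ := by
    rw [Real.cosh_eq]; linarith [Real.exp_pos τ]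
  have h2 : Real.exp (2 * τ) = Real.exp τ ^ 2 := by rw [← Real.exp_nat_mul]; norm_num
  have h3 : Real.exp (-τ) * Real.exp τ = 1 := by rw [← Real.exp_add]; simp
  rw [div_le_iff₀ (by positivity), h2]
  have h4 : 1 ≤ 2 * Real.exp τ * Real.cosh τ := by
    nlinarith [mul_le_mul_of_nonneg_left h1 (Real.exp_pos τ).le]
  nlinarith

/-- The squared distance of the state to the free motion `τ ↦ β + α τ`, shifted to time `τ₀`. -/
noncomputable def freeEnergy (τ₀ : ℝ) (f g : ℝ → ℝ) (τ : ℝ) : ℝ :=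
  g τ ^ 2 + (f τ - (τ - τ₀) * g τ) ^ 2

lemma SechSystem.hasDerivAt_freeEnergy {Λ : ℝ} {f g : ℝ → ℝ} (h : SechSystem Λ f g)
    (τ₀ τ : ℝ) :
    HasDerivAt (freeEnergy τ₀ f g)
      (2 * (Λ / Real.cosh τ ^ 2) * f τ *
        (-g τ + (τ - τ₀) * (f τ - (τ - τ₀) * g τ))) τ := by
  have hf := h.hasDerivAt_fst τ
  have hg := h.hasDerivAt_snd τ
  have hs : HasDerivAt (fun τ => τ - τ₀) 1 τ := (hasDerivAt_id τ).sub_const τ₀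
  have := (hg.fun_pow 2).fun_add ((hf.fun_sub (hs.fun_mul hg)).fun_pow 2)
  refine HasDerivAt.congr_deriv (f := freeEnergy τ₀ f g) this ?_
  push_cast
  ring

lemma SechSystem.abs_deriv_freeEnergy_le {Λ : ℝ} (hΛ : 0 < Λ) (f g : ℝ → ℝ) {τ₀ τ : ℝ}
    (hτ₀ : Λ * Real.exp (2 * τ₀) = 1) (hτ : τ ≤ τ₀) :
    |2 * (Λ / Real.cosh τ ^ 2) * f τ * (-g τ + (τ - τ₀) * (f τ - (τ - τ₀) * g τ))|
      ≤ 16 * Real.exp (τ - τ₀) * freeEnergy τ₀ f g τ := by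
  set σ := τ - τ₀ with hσ
  set p := g τ
  set q := f τ - σ * p with hq
  have hf : f τ = q + σ * p := by rw [hq]; ring
  have hV : Λ / Real.cosh τ ^ 2 ≤ 4 * Real.exp (2 * σ) := by
    have h1 : Real.exp (2 * τ) = Real.exp (2 * σ) * Real.exp (2 * τ₀) := by
      rw [← Real.exp_add]; congr 1; rw [hσ]; ring
    calc Λ / Real.cosh τ ^ 2 = Λ * (1 / Real.cosh τ ^ 2) := by ring
      _ ≤ Λ * (4 * Real.exp (2 * τ)) := by gcongr; exact inv_cosh_sq_le τ
      _ = 4 * Real.exp (2 * σ) * (Λ * Real.exp (2 * τ₀)) := by rw [h1]; ring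
      _ = _ := by rw [hτ₀, mul_one]
  have hV0 : 0 ≤ Λ / Real.cosh τ ^ 2 := by positivity
  have hprod : |(q + σ * p) * (-p + σ * q)| ≤ (1 + σ ^ 2) * (p ^ 2 + q ^ 2) := by
    rw [abs_le]
    constructor <;>
    nlinarith [sq_nonneg (q + σ * p - p + σ * q), sq_nonneg (q + σ * p + p - σ * q),
      sq_nonneg (q + σ * p), sq_nonneg (-p + σ * q)]
  have hE : Real.exp (2 * σ) = Real.exp σ * Real.exp σ := by rw [← Real.exp_add]; ring_nf
  have h2 := one_add_sq_mul_exp_le (show σ ≤ 0 by linarith)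
  have hN : freeEnergy τ₀ f g τ = p ^ 2 + q ^ 2 := rfl
  rw [hN, hf, show 2 * (Λ / Real.cosh τ ^ 2) * (q + σ * p) * (-p + σ * q)
    = 2 * (Λ / Real.cosh τ ^ 2) * ((q + σ * p) * (-p + σ * q)) by ring, abs_mul,
    abs_of_nonneg (by positivity : 0 ≤ 2 * (Λ / Real.cosh τ ^ 2))]
  calc _ ≤ 2 * (4 * Real.exp (2 * σ)) * ((1 + σ ^ 2) * (p ^ 2 + q ^ 2)) := by gcongr
    _ = 8 * ((1 + σ ^ 2) * Real.exp σ) * (Real.exp σ * (p ^ 2 + q ^ 2)) := by rw [hE]; ring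
    _ ≤ 8 * 2 * (Real.exp σ * (p ^ 2 + q ^ 2)) := by gcongr
    _ = _ := by ring

/-- Up to universal constants, the data at `-∞` control the state at time `τ₀ = -log √Λ`,
and conversely. -/
lemma SechSystem.freeEnergy_comparable {Λ : ℝ} (hΛ : 0 < Λ) {f g : ℝ → ℝ}
    (h : SechSystem Λ f g) {τ₀ α β : ℝ} (hτ₀ : Λ * Real.exp (2 * τ₀) = 1)
    (hα : Tendsto g atBot (nhds α))
    (hβ : Tendsto (fun τ => f τ - (τ - τ₀) * g τ) atBot (nhds β)) :
    g τ₀ ^ 2 + f τ₀ ^ 2 ≤ Real.exp 16 * (α ^ 2 + β ^ 2) ∧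
      α ^ 2 + β ^ 2 ≤ Real.exp 16 * (g τ₀ ^ 2 + f τ₀ ^ 2) := by
  have hlim : Tendsto (freeEnergy τ₀ f g) atBot (nhds (α ^ 2 + β ^ 2)) :=
    (hα.pow 2).add (hβ.pow 2)
  have hexp : Tendsto (fun τ => Real.exp (τ - τ₀)) atBot (nhds 0) :=
    Real.tendsto_exp_atBot.comp (tendsto_atBot_add_const_right _ _ tendsto_id)
  have hval : freeEnergy τ₀ f g τ₀ = g τ₀ ^ 2 + f τ₀ ^ 2 := by simp [freeEnergy]
  have hN0 : 0 ≤ g τ₀ ^ 2 + f τ₀ ^ 2 := by positivity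
  have hexpd : ∀ (c τ : ℝ), HasDerivAt (fun τ => Real.exp (c * Real.exp (τ - τ₀)))
      (Real.exp (c * Real.exp (τ - τ₀)) * (c * Real.exp (τ - τ₀))) τ := by
    intro c τ
    have hs : HasDerivAt (fun τ => τ - τ₀) 1 τ := (hasDerivAt_id τ).sub_const τ₀
    simpa using ((hs.exp).const_mul c).exp
  have hd : ∀ (c τ : ℝ), HasDerivAt
      (fun τ => freeEnergy τ₀ f g τ * Real.exp (c * Real.exp (τ - τ₀)))
      ((2 * (Λ / Real.cosh τ ^ 2) * f τ * (-g τ + (τ - τ₀) * (f τ - (τ - τ₀) * g τ))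
        + c * Real.exp (τ - τ₀) * freeEnergy τ₀ f g τ) *
          Real.exp (c * Real.exp (τ - τ₀))) τ := by
    intro c τ
    refine ((h.hasDerivAt_freeEnergy τ₀ τ).fun_mul (hexpd c τ)).congr_deriv ?_
    ring
  have hmono : MonotoneOn (fun τ => freeEnergy τ₀ f g τ * Real.exp (16 * Real.exp (τ - τ₀)))
      (Iic τ₀) := by
    refine monotoneOn_of_hasDerivWithinAt_nonneg (convex_Iic τ₀)
      (fun τ _ => (hd 16 τ).continuousAt.continuousWithinAt)
      (fun τ _ => (hd 16 τ).hasDerivWithinAt) fun τ hτ => ?_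
    rw [interior_Iic] at hτ
    have := (abs_le.1 (SechSystem.abs_deriv_freeEnergy_le hΛ f g hτ₀ (le_of_lt hτ))).1
    exact mul_nonneg (by linarith) (Real.exp_pos _).le
  have hanti : AntitoneOn
      (fun τ => freeEnergy τ₀ f g τ * Real.exp ((-16) * Real.exp (τ - τ₀))) (Iic τ₀) := by
    refine antitoneOn_of_hasDerivWithinAt_nonpos (convex_Iic τ₀)
      (fun τ _ => (hd (-16) τ).continuousAt.continuousWithinAt)
      (fun τ _ => (hd (-16) τ).hasDerivWithinAt) fun τ hτ => ?_
    rw [interior_Iic] at hτ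
    have := (abs_le.1 (SechSystem.abs_deriv_freeEnergy_le hΛ f g hτ₀ (le_of_lt hτ))).2
    exact mul_nonpos_of_nonpos_of_nonneg (by linarith) (Real.exp_pos _).le
  have hlimc : ∀ c : ℝ, Tendsto
      (fun τ => freeEnergy τ₀ f g τ * Real.exp (c * Real.exp (τ - τ₀))) atBot
      (nhds (α ^ 2 + β ^ 2)) := by
    intro c
    have := hlim.mul ((Real.continuous_exp.tendsto (c * 0)).comp (hexp.const_mul c))
    simpa [Function.comp_def] using this
  have hev : ∀ᶠ τ in atBot, τ ≤ τ₀ := eventually_le_atBot τ₀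
  constructor
  · have h1 : freeEnergy τ₀ f g τ₀ * Real.exp ((-16) * Real.exp (τ₀ - τ₀)) ≤ α ^ 2 + β ^ 2 :=
      ge_of_tendsto (hlimc (-16)) (hev.mono fun τ hτ => hanti hτ self_mem_Iic hτ)
    rw [hval, sub_self, Real.exp_zero, mul_one] at h1
    have h2 : Real.exp 16 * Real.exp (-16) = 1 := by rw [← Real.exp_add]; simp
    nlinarith [mul_le_mul_of_nonneg_left h1 (Real.exp_pos 16).le]
  · have h1 : α ^ 2 + β ^ 2 ≤ freeEnergy τ₀ f g τ₀ * Real.exp (16 * Real.exp (τ₀ - τ₀)) :=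
      le_of_tendsto (hlimc 16) (hev.mono fun τ hτ => hmono hτ self_mem_Iic hτ)
    rw [hval, sub_self, Real.exp_zero, mul_one] at h1
    linarith

/-- The squared frequency of the Liouville normal form. -/
noncomputable def liouvilleFreq (Λ τ : ℝ) : ℝ := Λ + 1 / 4 + Real.cosh τ ^ 2 / 4

/-- The energy of the Liouville normal form. -/
noncomputable def liouvilleEnergy (Λ : ℝ) (f g : ℝ → ℝ) (τ : ℝ) : ℝ :=
  Real.cosh τ * (g τ - Real.sinh τ / Real.cosh τ * f τ / 2) ^ 2
    + liouvilleFreq Λ τ * f τ ^ 2 / Real.cosh τ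

lemma hasDerivAt_liouvilleFreq (Λ τ : ℝ) :
    HasDerivAt (liouvilleFreq Λ) (Real.cosh τ * Real.sinh τ / 2) τ := by
  have := (((Real.hasDerivAt_cosh τ).fun_pow 2).div_const 4).const_add (Λ + 1 / 4)
  refine HasDerivAt.congr_deriv (f := liouvilleFreq Λ) this ?_
  push_cast
  ring

lemma liouvilleFreq_pos {Λ : ℝ} (hΛ : 0 < Λ) (τ : ℝ) : 0 < liouvilleFreq Λ τ := by
  unfold liouvilleFreq; positivity

lemma SechSystem.hasDerivAt_liouvilleEnergy {Λ : ℝ} {f g : ℝ → ℝ} (h : SechSystem Λ f g)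
    (τ : ℝ) :
    HasDerivAt (liouvilleEnergy Λ f g) (Real.sinh τ * f τ ^ 2 / 2) τ := by
  have hc := Real.hasDerivAt_cosh τ
  have hs := Real.hasDerivAt_sinh τ
  have hc0 : Real.cosh τ ≠ 0 := (Real.cosh_pos τ).ne'
  have hf := h.hasDerivAt_fst τ
  have hg := h.hasDerivAt_snd τ
  have h1 := hc.fun_mul ((hg.fun_sub (((hs.fun_div hc hc0).fun_mul hf).div_const 2)).fun_pow 2)
  have h2 := ((hasDerivAt_liouvilleFreq Λ τ).fun_mul (hf.fun_pow 2)).fun_div hc hc0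
  refine HasDerivAt.congr_deriv (f := liouvilleEnergy Λ f g) (h1.fun_add h2) ?_
  unfold liouvilleFreq
  have hsq : Real.sinh τ ^ 2 = Real.cosh τ ^ 2 - 1 := Real.sinh_sq τ
  simp only [Nat.cast_ofNat, Nat.add_one_sub_one, pow_one]
  field_simp
  ring_nf
  simp only [show Real.sinh τ ^ 3 = Real.sinh τ ^ 2 * Real.sinh τ by ring, hsq]
  field_simp
  ring

lemma SechSystem.liouvilleEnergy_zero_le {Λ : ℝ} {f g : ℝ → ℝ} (h : SechSystem Λ f g)
    {τ : ℝ} (hτ : τ ≤ 0) : liouvilleEnergy Λ f g 0 ≤ liouvilleEnergy Λ f g τ := by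
  have hanti : AntitoneOn (liouvilleEnergy Λ f g) (Iic 0) := by
    refine antitoneOn_of_hasDerivWithinAt_nonpos (convex_Iic 0)
      (fun τ _ => (h.hasDerivAt_liouvilleEnergy τ).continuousAt.continuousWithinAt)
      (fun τ _ => (h.hasDerivAt_liouvilleEnergy τ).hasDerivWithinAt) fun τ hτ => ?_
    rw [interior_Iic] at hτ
    have : Real.sinh τ < 0 := Real.sinh_neg_iff.2 hτ
    nlinarith [sq_nonneg (f τ)]
  exact hanti hτ self_mem_Iic hτ

lemma SechSystem.liouvilleEnergy_div_freq_le {Λ : ℝ} (hΛ : 0 < Λ) {f g : ℝ → ℝ}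
    (h : SechSystem Λ f g) {τ : ℝ} (hτ : 0 ≤ τ) :
    liouvilleEnergy Λ f g τ / liouvilleFreq Λ τ
      ≤ liouvilleEnergy Λ f g 0 / liouvilleFreq Λ 0 := by
  have hd := fun τ => (h.hasDerivAt_liouvilleEnergy τ).fun_div (hasDerivAt_liouvilleFreq Λ τ)
    (liouvilleFreq_pos hΛ τ).ne'
  have hanti : AntitoneOn (fun τ => liouvilleEnergy Λ f g τ / liouvilleFreq Λ τ) (Ici 0) := by
    refine antitoneOn_of_hasDerivWithinAt_nonpos (convex_Ici 0)
      (fun τ _ => (hd τ).continuousAt.continuousWithinAt)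
      (fun τ _ => (hd τ).hasDerivWithinAt) fun τ hτ => ?_
    rw [interior_Ici] at hτ
    have hs : 0 < Real.sinh τ := Real.sinh_pos_iff.2 hτ
    refine div_nonpos_of_nonpos_of_nonneg ?_ (sq_nonneg _)
    have hc := Real.cosh_pos τ
    have : Real.sinh τ * f τ ^ 2 / 2 * liouvilleFreq Λ τ
        - liouvilleEnergy Λ f g τ * (Real.cosh τ * Real.sinh τ / 2)
        = -(Real.sinh τ * Real.cosh τ ^ 2 / 2
            * (g τ - Real.sinh τ / Real.cosh τ * f τ / 2) ^ 2) := by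
      unfold liouvilleEnergy
      field_simp
      ring
    rw [this]
    exact neg_nonpos.2 (by positivity)
  exact hanti self_mem_Ici hτ hτ

lemma sq_sub_half_mul_bounds {T : ℝ} (hT : T ^ 2 ≤ 1) (a b : ℝ) :
    a ^ 2 / 2 - b ^ 2 / 4 ≤ (a - T * b / 2) ^ 2 ∧ (a - T * b / 2) ^ 2 ≤ 2 * a ^ 2 + b ^ 2 := by
  have h := mul_le_mul_of_nonneg_right hT (sq_nonneg b)
  constructor
  · linarith [sq_nonneg (a - T * b)]
  · linarith [sq_nonneg (a + T * b / 2), sq_nonneg b]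

/-- The state at time `τ₀ = -log √Λ` controls the states at times `0` and `-τ₀`. -/
lemma SechSystem.transition_bound {Λ : ℝ} (hΛ : 1 ≤ Λ) {f g : ℝ → ℝ}
    (h : SechSystem Λ f g) {τ₀ : ℝ} (hτ₀ : Λ * Real.exp (2 * τ₀) = 1) :
    g 0 ^ 2 + f 0 ^ 2 ≤ 6 * Λ * (g τ₀ ^ 2 + f τ₀ ^ 2) ∧
      g (-τ₀) ^ 2 + f (-τ₀) ^ 2 ≤ 72 * (g τ₀ ^ 2 + f τ₀ ^ 2) := by
  have hΛ0 : 0 < Λ := by linarith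
  set r := Real.exp (-τ₀) with hr
  have hr0 : 0 < r := Real.exp_pos _
  have hexp2 : Real.exp (2 * τ₀) = Real.exp τ₀ ^ 2 := by rw [← Real.exp_nat_mul]; norm_num
  have hrinv : r * Real.exp τ₀ = 1 := by rw [hr, ← Real.exp_add]; simp
  have hrsq : r ^ 2 = Λ := by
    have : r ^ 2 * (Λ * Real.exp (2 * τ₀)) = Λ * (r * Real.exp τ₀) ^ 2 := by rw [hexp2]; ring
    rwa [hτ₀, hrinv, mul_one, one_pow, mul_one] at this
  have hr1 : 1 ≤ r := (one_le_sq_iff₀ hr0.le).1 (hrsq ▸ hΛ)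
  have hτ0 : τ₀ ≤ 0 := by
    have : Real.exp 0 ≤ Real.exp (-τ₀) := by rw [Real.exp_zero]; exact hr1
    linarith [Real.exp_le_exp.1 this]
  have hc : Real.cosh τ₀ = (Real.exp τ₀ + r) / 2 := by rw [Real.cosh_eq]
  have he1 : Real.exp τ₀ ≤ 1 := Real.exp_le_one_iff.2 hτ0
  have hc1 : Real.cosh τ₀ ≤ r := by rw [hc]; linarith
  have hc2 : r / 2 ≤ Real.cosh τ₀ := by rw [hc]; linarith [Real.exp_pos τ₀]
  have hc0 := Real.cosh_pos τ₀
  have hT : (Real.sinh τ₀ / Real.cosh τ₀) ^ 2 ≤ 1 := by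
    rw [div_pow, div_le_one (by positivity), Real.sinh_sq]; linarith
  generalize hTdef : Real.sinh τ₀ / Real.cosh τ₀ = T at hT
  have hW : liouvilleFreq Λ τ₀ ≤ 3 / 2 * Λ := by
    unfold liouvilleFreq; linarith [pow_le_pow_left₀ hc0.le hc1 2]
  have hW0 : liouvilleFreq Λ 0 = Λ + 1 / 2 := by
    unfold liouvilleFreq; rw [Real.cosh_zero]; ring
  have hE0 : liouvilleEnergy Λ f g 0 = g 0 ^ 2 + (Λ + 1 / 2) * f 0 ^ 2 := by
    unfold liouvilleEnergy; rw [hW0]; simp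
  have hEin : liouvilleEnergy Λ f g τ₀ ≤ 6 * r * (g τ₀ ^ 2 + f τ₀ ^ 2) := by
    unfold liouvilleEnergy
    rw [hTdef]
    have e1 : (g τ₀ - T * f τ₀ / 2) ^ 2 ≤ 2 * g τ₀ ^ 2 + f τ₀ ^ 2 :=
      (sq_sub_half_mul_bounds hT _ _).2
    have e2 : liouvilleFreq Λ τ₀ * f τ₀ ^ 2 / Real.cosh τ₀ ≤ 3 * r * f τ₀ ^ 2 := by
      rw [div_le_iff₀ hc0]
      calc liouvilleFreq Λ τ₀ * f τ₀ ^ 2 ≤ 3 / 2 * Λ * f τ₀ ^ 2 := by gcongr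
        _ = 3 * r * f τ₀ ^ 2 * (r / 2) := by rw [← hrsq]; ring
        _ ≤ _ := by gcongr
    calc _ ≤ r * (2 * g τ₀ ^ 2 + f τ₀ ^ 2) + 3 * r * f τ₀ ^ 2 := by gcongr
      _ ≤ _ := by linarith [mul_nonneg hr0.le (sq_nonneg (f τ₀)),
                    mul_nonneg hr0.le (sq_nonneg (g τ₀))]
  have hmid := h.liouvilleEnergy_zero_le hτ0
  have hmid' := h.liouvilleEnergy_div_freq_le hΛ0 (neg_nonneg.2 hτ0)
  have hfreq : liouvilleFreq Λ (-τ₀) = liouvilleFreq Λ τ₀ := by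
    unfold liouvilleFreq; rw [Real.cosh_neg]
  have hEout : liouvilleEnergy Λ f g (-τ₀) ≤ 3 / 2 * liouvilleEnergy Λ f g 0 := by
    have hnn : 0 ≤ liouvilleEnergy Λ f g 0 := by rw [hE0]; positivity
    rw [hfreq, hW0, div_le_div_iff₀ (liouvilleFreq_pos hΛ0 _) (by positivity)] at hmid'
    have e1 := mul_le_mul_of_nonneg_left hW hnn
    have e2 : liouvilleEnergy Λ f g (-τ₀) * (Λ + 1 / 2)
        ≤ (3 / 2 * liouvilleEnergy Λ f g 0) * (Λ + 1 / 2) := by linarith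
    exact le_of_mul_le_mul_right e2 (by positivity)
  have hEout' : r / 8 * (g (-τ₀) ^ 2 + f (-τ₀) ^ 2) ≤ liouvilleEnergy Λ f g (-τ₀) := by
    unfold liouvilleEnergy
    rw [hfreq, Real.cosh_neg, Real.sinh_neg, neg_div, hTdef]
    have e2 : r * f (-τ₀) ^ 2 ≤ liouvilleFreq Λ τ₀ * f (-τ₀) ^ 2 / Real.cosh τ₀ := by
      rw [le_div_iff₀ hc0]
      calc r * f (-τ₀) ^ 2 * Real.cosh τ₀ ≤ r * f (-τ₀) ^ 2 * r := by gcongr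
        _ = Λ * f (-τ₀) ^ 2 := by rw [← hrsq]; ring
        _ ≤ _ := by gcongr; unfold liouvilleFreq; linarith [sq_nonneg (Real.cosh τ₀)]
    have e1 : g (-τ₀) ^ 2 / 2 - f (-τ₀) ^ 2 / 4 ≤ (g (-τ₀) - -T * f (-τ₀) / 2) ^ 2 :=
      (sq_sub_half_mul_bounds (by rwa [neg_sq]) _ _).1
    have e3 : r / 2 * (g (-τ₀) - -T * f (-τ₀) / 2) ^ 2
        ≤ Real.cosh τ₀ * (g (-τ₀) - -T * f (-τ₀) / 2) ^ 2 := by gcongr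
    have e4 := mul_le_mul_of_nonneg_left e1 (half_pos hr0).le
    have e5 := mul_nonneg hr0.le (sq_nonneg (f (-τ₀)))
    have e6 := mul_nonneg hr0.le (sq_nonneg (g (-τ₀)))
    linarith
  constructor
  · have : g 0 ^ 2 + f 0 ^ 2 ≤ liouvilleEnergy Λ f g 0 := by
      rw [hE0]; linarith [mul_le_mul_of_nonneg_right hΛ (sq_nonneg (f 0)), sq_nonneg (f 0)]
    have hrΛ : r ≤ Λ := hrsq ▸ le_self_pow₀ hr1 two_ne_zero
    calc g 0 ^ 2 + f 0 ^ 2 ≤ 6 * r * (g τ₀ ^ 2 + f τ₀ ^ 2) := by linarith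
      _ ≤ 6 * Λ * (g τ₀ ^ 2 + f τ₀ ^ 2) := by gcongr
  · have e1 : r / 8 * (g (-τ₀) ^ 2 + f (-τ₀) ^ 2)
        ≤ r / 8 * (72 * (g τ₀ ^ 2 + f τ₀ ^ 2)) := by linarith
    exact le_of_mul_le_mul_left e1 (by positivity)

/-- Uniform bound for the scattering of `f'' + Λ sech² f = 0` between the renormalized free
asymptotics `α (τ ± log √Λ) + β` at `∓∞`, and for the state at time zero. -/
lemma SechSystem.scattering_bound {Λ : ℝ} (hΛ : 1 ≤ Λ) {f g : ℝ → ℝ}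
    (h : SechSystem Λ f g) {τ₀ α β α' β' : ℝ} (hτ₀ : Λ * Real.exp (2 * τ₀) = 1)
    (hα : Tendsto g atBot (nhds α))
    (hβ : Tendsto (fun τ => f τ - (τ - τ₀) * g τ) atBot (nhds β))
    (hα' : Tendsto (fun τ => -g (-τ)) atBot (nhds α'))
    (hβ' : Tendsto (fun τ => f (-τ) - (τ - τ₀) * -g (-τ)) atBot (nhds β')) :
    g 0 ^ 2 + f 0 ^ 2 ≤ 6 * Λ * Real.exp 16 * (α ^ 2 + β ^ 2) ∧
      α' ^ 2 + β' ^ 2 ≤ 72 * Real.exp 32 * (α ^ 2 + β ^ 2) := by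
  have hΛ0 : 0 < Λ := by linarith
  have hin := (h.freeEnergy_comparable hΛ0 hτ₀ hα hβ).1
  have hout := (h.reflect.freeEnergy_comparable hΛ0 hτ₀ hα' hβ').2
  obtain ⟨hmid, hend⟩ := h.transition_bound hΛ hτ₀
  have hp := Real.exp_pos 16
  have hexp32 : Real.exp 32 = Real.exp 16 * Real.exp 16 := by rw [← Real.exp_add]; norm_num
  constructor
  · calc g 0 ^ 2 + f 0 ^ 2 ≤ 6 * Λ * (g τ₀ ^ 2 + f τ₀ ^ 2) := hmid
      _ ≤ 6 * Λ * (Real.exp 16 * (α ^ 2 + β ^ 2)) := by gcongr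
      _ = _ := by ring
  · calc α' ^ 2 + β' ^ 2 ≤ Real.exp 16 * (g (-τ₀) ^ 2 + f (-τ₀) ^ 2) := by
          simpa using hout
      _ ≤ Real.exp 16 * (72 * (Real.exp 16 * (α ^ 2 + β ^ 2))) := by gcongr; linarith
      _ = _ := by rw [hexp32]; ring

/-- The zeroth-order coefficient of the equation solved by the `j`-th derivative of a solution of
`(1 - x²) F'' + (2k - 2) x F' + μ F = 0`. -/
noncomputable def towerCoeff (k : ℕ) (μ : ℝ) (j : ℕ) : ℝ := μ + j * (2 * k - 1 - j)

/-- `F j` is the `j`-th derivative of a solution of `(1 - x²) F'' + (2k - 2) x F' + μ F = 0` on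
`(-1, 1)`; the `k`-th derivative solves a Legendre equation. -/
structure DerivTower (k : ℕ) (μ : ℝ) (F : ℕ → ℝ → ℝ) : Prop where
  hasDerivAt : ∀ j, ∀ x ∈ Ioo (-1 : ℝ) 1, HasDerivAt (F j) (F (j + 1) x) x
  ode : ∀ j, ∀ x ∈ Ioo (-1 : ℝ) 1, (1 - x ^ 2) * F (j + 2) x
    + (2 * k - 2 - 2 * j) * x * F (j + 1) x + towerCoeff k μ j * F j x = 0

lemma one_le_mul_sub {k j : ℕ} (hj : 1 ≤ j) (hjk : j + 1 ≤ k) :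
    (1 : ℝ) ≤ j * (2 * k - 1 - j) := by
  have h1 : (1 : ℝ) ≤ j := by exact_mod_cast hj
  have h2 : (j : ℝ) + 1 ≤ k := by exact_mod_cast hjk
  nlinarith

lemma DerivTower.of_hasDerivAt {k : ℕ} {μ : ℝ} {F : ℕ → ℝ → ℝ}
    (hF : ∀ j, ∀ x ∈ Ioo (-1 : ℝ) 1, HasDerivAt (F j) (F (j + 1) x) x)
    (h0 : ∀ x ∈ Ioo (-1 : ℝ) 1,
      (1 - x ^ 2) * F 2 x + (2 * k - 2) * x * F 1 x + μ * F 0 x = 0) :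
    DerivTower k μ F where
  hasDerivAt := hF
  ode j := by
    induction j with
    | zero => intro x hx; simpa [towerCoeff] using h0 x hx
    | succ j ih =>
      intro x hx
      have hx1 : HasDerivAt (fun x : ℝ => 1 - x ^ 2) (-(2 * x)) x := by
        simpa using (hasDerivAt_pow 2 x).const_sub 1
      have hx2 : HasDerivAt (fun x : ℝ => (2 * (k : ℝ) - 2 - 2 * j) * x) (2 * k - 2 - 2 * j) x := by
        simpa using (hasDerivAt_id x).const_mul (2 * (k : ℝ) - 2 - 2 * j)
      have hd := ((hx1.fun_mul (hF (j + 2) x hx)).fun_add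
        (hx2.fun_mul (hF (j + 1) x hx))).fun_add
          ((hF j x hx).const_mul (towerCoeff k μ j))
      have hz := hd.unique ((hasDerivAt_const x (0 : ℝ)).congr_of_eventuallyEq <| by
        filter_upwards [isOpen_Ioo.mem_nhds hx] with y hy
        exact ih y hy)
      rw [← hz]
      simp only [towerCoeff]
      push_cast
      ring

lemma DerivTower.reflect {k : ℕ} {μ : ℝ} {F : ℕ → ℝ → ℝ} (h : DerivTower k μ F) :
    DerivTower k μ (fun j x => (-1) ^ j * F j (-x)) where
  hasDerivAt j x hx := by
    have hx' : -x ∈ Ioo (-1 : ℝ) 1 := ⟨by linarith [hx.2], by linarith [hx.1]⟩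
    have := ((h.hasDerivAt j (-x) hx').scomp x (hasDerivAt_neg x)).const_mul ((-1) ^ j)
    refine this.congr_deriv ?_
    rw [smul_eq_mul]
    ring
  ode j x hx := by
    have hx' : -x ∈ Ioo (-1 : ℝ) 1 := ⟨by linarith [hx.2], by linarith [hx.1]⟩
    have := h.ode j (-x) hx'
    linear_combination (-1) ^ j * this

lemma DerivTower.ode_zero {k : ℕ} {μ : ℝ} {F : ℕ → ℝ → ℝ} (h : DerivTower k μ F) (j : ℕ) :
    F (j + 2) 0 = -(towerCoeff k μ j * F j 0) := by
  have := h.ode j 0 (by norm_num)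
  linear_combination this

/-- Every derivative of positive order at most `k + 1` is controlled at the origin by the two
highest ones. -/
lemma DerivTower.sq_zero_le {k : ℕ} {μ : ℝ} (hμ : 0 ≤ μ) {F : ℕ → ℝ → ℝ}
    (h : DerivTower k μ F) {j : ℕ} (hj : 1 ≤ j) (hjk : j ≤ k + 1) :
    F j 0 ^ 2 ≤ F (k + 1) 0 ^ 2 + F k 0 ^ 2 := by
  obtain ⟨d, hd⟩ := Nat.exists_eq_add_of_le hjk
  induction d using Nat.strong_induction_on generalizing j with
  | _ d ih =>
    rcases d with _ | _ | d
    · obtain rfl : j = k + 1 := by omega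
      linarith [sq_nonneg (F k 0)]
    · obtain rfl : j = k := by omega
      linarith [sq_nonneg (F (j + 1) 0)]
    · have h2 := ih d (by omega) (j := j + 2) (by omega) (by omega) (by omega)
      refine le_trans ?_ h2
      rw [h.ode_zero, neg_sq, mul_pow]
      have h1 : 1 ≤ towerCoeff k μ j := by
        have := one_le_mul_sub hj (show j + 1 ≤ k by omega)
        unfold towerCoeff; linarith
      exact le_mul_of_one_le_left (sq_nonneg _) (one_le_pow₀ h1)

lemma DerivTower.one_sq_le_of_nonneg {k : ℕ} (hk : 2 ≤ k) {μ : ℝ} (hμ : 0 ≤ μ)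
    {F : ℕ → ℝ → ℝ} (h : DerivTower k μ F) {x : ℝ} (hx : x ∈ Ico (0 : ℝ) 1) :
    F 1 x ^ 2 ≤ 2 * (F (k + 1) 0 ^ 2 + F k 0 ^ 2) := by
  have hk' : (2 : ℝ) ≤ k := by exact_mod_cast hk
  have hsub : Ico (0 : ℝ) 1 ⊆ Ioo (-1) 1 := fun y hy => ⟨by linarith [hy.1], hy.2⟩
  have hd : ∀ y ∈ Ico (0 : ℝ) 1, HasDerivAt
      (fun y => (1 - y ^ 2) * F 2 y ^ 2 + towerCoeff k μ 1 * F 1 y ^ 2)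
      (-(2 * (2 * k - 3) * y * F 2 y ^ 2)) y := by
    intro y hy
    have hx1 : HasDerivAt (fun x : ℝ => 1 - x ^ 2) (-(2 * y)) y := by
      simpa using (hasDerivAt_pow 2 y).const_sub 1
    have h1 := h.hasDerivAt 1 y (hsub hy)
    have h2 := h.hasDerivAt 2 y (hsub hy)
    have hode := h.ode 1 y (hsub hy)
    refine ((hx1.fun_mul (h2.fun_pow 2)).fun_add
      ((h1.fun_pow 2).const_mul (towerCoeff k μ 1))).congr_deriv ?_
    simp only [Nat.cast_ofNat, Nat.add_one_sub_one, pow_one, Nat.reduceAdd, Nat.cast_one]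
      at hode ⊢
    linear_combination 2 * F 2 y * hode
  have hanti : AntitoneOn
      (fun y => (1 - y ^ 2) * F 2 y ^ 2 + towerCoeff k μ 1 * F 1 y ^ 2) (Ico 0 1) := by
    refine antitoneOn_of_hasDerivWithinAt_nonpos (convex_Ico 0 1)
      (fun y hy => (hd y hy).continuousAt.continuousWithinAt)
      (fun y hy => (hd y (interior_subset hy)).hasDerivWithinAt) fun y hy => ?_
    have h0 : 0 ≤ y := (interior_subset hy : y ∈ Ico (0 : ℝ) 1).1
    have h3 : (0 : ℝ) ≤ 2 * k - 3 := by linarith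
    exact neg_nonpos.2 (by positivity)
  have hle := hanti ⟨le_rfl, one_pos⟩ hx hx.1
  have hΛ : 1 ≤ towerCoeff k μ 1 := by
    have := one_le_mul_sub le_rfl hk
    unfold towerCoeff; linarith
  have h1 := h.sq_zero_le hμ (j := 1) le_rfl (by omega)
  have h2 := h.sq_zero_le hμ (j := 2) (by omega) (by omega)
  have hx2 : 0 ≤ (1 - x ^ 2) * F 2 x ^ 2 :=
    mul_nonneg (by nlinarith [hx.1, hx.2]) (sq_nonneg _)
  simp only [ne_eq, OfNat.ofNat_ne_zero, not_false_eq_true, zero_pow, sub_zero, one_mul] at hle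
  have h3 : towerCoeff k μ 1 * F 1 x ^ 2
      ≤ towerCoeff k μ 1 * (2 * (F (k + 1) 0 ^ 2 + F k 0 ^ 2)) := by
    nlinarith [sq_nonneg (F 1 0), sq_nonneg (F 2 0)]
  exact le_of_mul_le_mul_left h3 (by linarith)

lemma DerivTower.one_sq_le {k : ℕ} (hk : 2 ≤ k) {μ : ℝ} (hμ : 0 ≤ μ)
    {F : ℕ → ℝ → ℝ} (h : DerivTower k μ F) {x : ℝ} (hx : x ∈ Ioo (-1 : ℝ) 1) :
    F 1 x ^ 2 ≤ 2 * (F (k + 1) 0 ^ 2 + F k 0 ^ 2) := by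
  rcases le_total 0 x with h0 | h0
  · exact h.one_sq_le_of_nonneg hk hμ ⟨h0, hx.2⟩
  · have := h.reflect.one_sq_le_of_nonneg hk hμ (x := -x) ⟨by linarith, by linarith [hx.1]⟩
    simpa [mul_pow, ← pow_mul, mul_comm _ 2] using this

/-- The oscillation of the solution itself is controlled by the state of the Legendre equation
at the origin. -/
lemma DerivTower.sq_sub_le {k : ℕ} (hk : 2 ≤ k) {μ : ℝ} (hμ : 0 ≤ μ)
    {F : ℕ → ℝ → ℝ} (h : DerivTower k μ F) {x y : ℝ} (hx : x ∈ Ioo (-1 : ℝ) 1)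
    (hy : y ∈ Ioo (-1 : ℝ) 1) :
    (F 0 y - F 0 x) ^ 2 ≤ 8 * (F (k + 1) 0 ^ 2 + F k 0 ^ 2) := by
  set S := F (k + 1) 0 ^ 2 + F k 0 ^ 2
  have hS : 0 ≤ S := by positivity
  have hb := (convex_Ioo (-1 : ℝ) 1).norm_image_sub_le_of_norm_hasDerivWithin_le
    (fun z hz => (h.hasDerivAt 0 z hz).hasDerivWithinAt) (C := √(2 * S))
    (fun z hz => by
      rw [Real.norm_eq_abs]
      exact Real.abs_le_sqrt (h.one_sq_le hk hμ hz)) hx hy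
  rw [Real.norm_eq_abs, Real.norm_eq_abs] at hb
  have hxy : |y - x| ≤ 2 := abs_le.2 ⟨by linarith [hx.2, hy.1], by linarith [hx.1, hy.2]⟩
  calc (F 0 y - F 0 x) ^ 2 = |F 0 y - F 0 x| ^ 2 := (sq_abs _).symm
    _ ≤ (√(2 * S) * 2) ^ 2 := by
        gcongr
        exact hb.trans (by gcongr)
    _ = 8 * S := by rw [mul_pow, Real.sq_sqrt (by positivity)]; ring

lemma one_sub_tanh_sq (τ : ℝ) : 1 - Real.tanh τ ^ 2 = 1 / Real.cosh τ ^ 2 := by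
  have hc := (Real.cosh_pos τ).ne'
  rw [Real.tanh_eq_sinh_div_cosh, div_pow, Real.sinh_sq]
  field_simp
  ring

lemma hasDerivAt_tanh (τ : ℝ) : HasDerivAt Real.tanh (1 / Real.cosh τ ^ 2) τ := by
  have hc := (Real.cosh_pos τ).ne'
  have h := (Real.hasDerivAt_sinh τ).fun_div (Real.hasDerivAt_cosh τ) hc
  rw [show Real.tanh = fun τ => Real.sinh τ / Real.cosh τ from
    funext Real.tanh_eq_sinh_div_cosh]
  refine h.congr_deriv ?_
  rw [← sq, ← sq, Real.sinh_sq]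
  ring

/-- In the variable `x = tanh τ`, the Legendre equation for the `k`-th derivative becomes
`f'' + Λ sech² f = 0` with `Λ = μ + k (k - 1)`. -/
lemma DerivTower.sechSystem {k : ℕ} {μ : ℝ} {F : ℕ → ℝ → ℝ} (h : DerivTower k μ F) :
    SechSystem (μ + k * (k - 1)) (fun τ => F k (Real.tanh τ))
      (fun τ => F (k + 1) (Real.tanh τ) / Real.cosh τ ^ 2) where
  hasDerivAt_fst τ := by
    have := (h.hasDerivAt k _ ⟨Real.neg_one_lt_tanh τ, Real.tanh_lt_one τ⟩).comp τ
      (hasDerivAt_tanh τ)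
    simpa [Function.comp_def, div_eq_mul_inv] using this
  hasDerivAt_snd τ := by
    have hmem : Real.tanh τ ∈ Ioo (-1 : ℝ) 1 := ⟨Real.neg_one_lt_tanh τ, Real.tanh_lt_one τ⟩
    have hc := (Real.cosh_pos τ).ne'
    have h1 := ((h.hasDerivAt (k + 1) _ hmem).comp τ (hasDerivAt_tanh τ)).fun_div
      ((Real.hasDerivAt_cosh τ).fun_pow 2) (pow_ne_zero 2 hc)
    have hode := h.ode k _ hmem
    rw [one_sub_tanh_sq] at hode
    refine h1.congr_deriv ?_
    have hs : Real.sinh τ = Real.tanh τ * Real.cosh τ := by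
      rw [Real.tanh_eq_sinh_div_cosh]; field_simp
    rw [hs]
    simp only [Function.comp_apply, Nat.cast_ofNat, Nat.add_one_sub_one, pow_one, towerCoeff]
      at hode ⊢
    field_simp at hode ⊢
    linear_combination hode

/-- The coefficients of `(d/dv)^j` in terms of `(d/dx)^a`, where `x = (v - 1) / (v + 1)`. -/
noncomputable def cayleyCoeff : ℕ → ℕ → ℝ
  | 0, 0 => 1
  | 0, _ + 1 => 0
  | j + 1, 0 => -j * cayleyCoeff j 0
  | j + 1, a + 1 => -(j + (a + 1)) * cayleyCoeff j (a + 1) + 2 * cayleyCoeff j a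

lemma cayleyCoeff_of_lt {j a : ℕ} (h : j < a) : cayleyCoeff j a = 0 := by
  induction j generalizing a with
  | zero =>
    obtain ⟨a, rfl⟩ := Nat.exists_eq_add_of_lt h
    simp [cayleyCoeff]
  | succ j ih =>
    obtain ⟨a, rfl⟩ : ∃ b, a = b + 1 := ⟨a - 1, by omega⟩
    rw [cayleyCoeff, ih (by omega), ih (by omega)]
    ring

lemma cayleyCoeff_self (j : ℕ) : cayleyCoeff j j = 2 ^ j := by
  induction j with
  | zero => simp [cayleyCoeff]
  | succ j ih =>
    rw [cayleyCoeff, ih, cayleyCoeff_of_lt (Nat.lt_succ_self j)]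
    ring

lemma cayley_mem {v : ℝ} (hv : 0 < v) : (v - 1) / (v + 1) ∈ Ioo (-1 : ℝ) 1 := by
  constructor
  · rw [lt_div_iff₀ (by linarith)]; linarith
  · rw [div_lt_one (by linarith)]; linarith

lemma hasDerivAt_cayley {v : ℝ} (hv : 0 < v) :
    HasDerivAt (fun v : ℝ => (v - 1) / (v + 1)) (2 * ((1 + v)⁻¹) ^ 2) v := by
  have h1 : HasDerivAt (fun v : ℝ => v - 1) 1 v := (hasDerivAt_id v).sub_const 1
  have h2 : HasDerivAt (fun v : ℝ => v + 1) 1 v := (hasDerivAt_id v).add_const 1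
  have h3 : v + 1 ≠ 0 := by linarith
  have h4 : 1 + v ≠ 0 := by linarith
  refine (h1.fun_div h2 h3).congr_deriv ?_
  field_simp
  ring

lemma hasDerivAt_inv_one_add_pow {v : ℝ} (hv : 0 < v) (m : ℕ) :
    HasDerivAt (fun v : ℝ => (1 + v)⁻¹ ^ m) (-(m * (1 + v)⁻¹ ^ (m + 1))) v := by
  have h2 : HasDerivAt (fun v : ℝ => 1 + v) 1 v := (hasDerivAt_id v).const_add 1
  have h4 : 1 + v ≠ 0 := by linarith
  refine ((h2.fun_inv h4).fun_pow m).congr_deriv ?_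
  rcases m with _ | m
  · simp
  · rw [show -1 / (1 + v) ^ 2 = -((1 + v)⁻¹ ^ 2) by rw [inv_pow, neg_div, one_div],
      Nat.add_one_sub_one]
    ring

/-- The derivatives with respect to `x` of `ψ`, where `v = (1 + x) / (1 - x)`. -/
noncomputable def cayleyTower (ψ : ℝ → ℝ) (j : ℕ) : ℝ → ℝ :=
  iteratedDeriv j (fun x => ψ ((1 + x) / (1 - x)))

lemma hasDerivAt_iteratedDeriv {f : ℝ → ℝ} {x : ℝ} (h : ContDiffAt ℝ (⊤ : ℕ∞) f x) (j : ℕ) :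
    HasDerivAt (iteratedDeriv j f) (iteratedDeriv (j + 1) f x) x := by
  rw [iteratedDeriv_succ]
  refine DifferentiableAt.hasDerivAt ?_
  rw [← iteratedDerivWithin_univ]
  rw [← contDiffWithinAt_univ] at h
  have := h.differentiableWithinAt_iteratedDerivWithin (m := j)
    (by exact_mod_cast WithTop.coe_lt_top _) (by simp)
  exact differentiableWithinAt_univ.1 (by simpa using this)

lemma hasDerivAt_cayleyTower {ψ : ℝ → ℝ} (hψ : ContDiffOn ℝ (⊤ : ℕ∞) ψ (Ioi 0)) (j : ℕ)
    {x : ℝ} (hx : x ∈ Ioo (-1 : ℝ) 1) :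
    HasDerivAt (cayleyTower ψ j) (cayleyTower ψ (j + 1) x) x := by
  refine hasDerivAt_iteratedDeriv ?_ j
  have hv : 0 < (1 + x) / (1 - x) := div_pos (by linarith [hx.1]) (by linarith [hx.2])
  refine ContDiffAt.comp x (hψ.contDiffAt (Ioi_mem_nhds hv)) ?_
  exact (contDiffAt_const.add contDiffAt_id).div (contDiffAt_const.sub contDiffAt_id)
    (sub_pos.2 hx.2).ne'

lemma cayleyTower_zero (ψ : ℝ → ℝ) {v : ℝ} (hv : 0 < v) :
    cayleyTower ψ 0 ((v - 1) / (v + 1)) = ψ v := by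
  have h1 : v + 1 ≠ 0 := by linarith
  simp only [cayleyTower, iteratedDeriv_zero]
  congr 1
  have h2 : 1 - (v - 1) / (v + 1) ≠ 0 := by
    rw [sub_ne_zero]; exact (cayley_mem hv).2.ne'
  rw [div_eq_iff h2]
  field_simp
  ring

lemma iteratedDeriv_eq_sum_cayleyTower {ψ : ℝ → ℝ}
    (hψ : ContDiffOn ℝ (⊤ : ℕ∞) ψ (Ioi 0)) (j : ℕ) {v : ℝ} (hv : 0 < v) :
    iteratedDeriv j ψ v = ∑ a ∈ Finset.range (j + 1),
      cayleyCoeff j a * (1 + v)⁻¹ ^ (j + a) * cayleyTower ψ a ((v - 1) / (v + 1)) := by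
  induction j generalizing v with
  | zero => simp [cayleyCoeff, cayleyTower_zero ψ hv]
  | succ j ih =>
    set z := (1 + v)⁻¹
    set G := fun a => cayleyTower ψ a ((v - 1) / (v + 1)) with hG
    have hsum : HasDerivAt (fun v => ∑ a ∈ Finset.range (j + 1),
        cayleyCoeff j a * (1 + v)⁻¹ ^ (j + a) * cayleyTower ψ a ((v - 1) / (v + 1)))
        (∑ a ∈ Finset.range (j + 1), (-(j + a) * cayleyCoeff j a * z ^ (j + a + 1) * G a
          + 2 * cayleyCoeff j a * z ^ (j + a + 2) * G (a + 1))) v := by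
      refine HasDerivAt.fun_sum fun a _ => ?_
      have h1 := (hasDerivAt_inv_one_add_pow hv (j + a)).const_mul (cayleyCoeff j a)
      have h2 := (hasDerivAt_cayleyTower hψ a (cayley_mem hv)).comp v (hasDerivAt_cayley hv)
      refine (h1.fun_mul h2).congr_deriv ?_
      simp only [hG, Function.comp_apply]
      push_cast
      ring
    have hd : HasDerivAt (iteratedDeriv j ψ) (iteratedDeriv (j + 1) ψ v) v :=
      hasDerivAt_iteratedDeriv (hψ.contDiffAt (Ioi_mem_nhds hv)) j
    rw [hd.unique (hsum.congr_of_eventuallyEq <| by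
      filter_upwards [Ioi_mem_nhds hv] with w hw using ih hw),
      Finset.sum_add_distrib, Finset.sum_range_succ' _ (j + 1)]
    have e1 : ∑ a ∈ Finset.range (j + 1), -(j + a) * cayleyCoeff j a * z ^ (j + a + 1) * G a
        = (∑ a ∈ Finset.range (j + 1), -(j + (a + 1)) * cayleyCoeff j (a + 1)
            * z ^ (j + (a + 1) + 1) * G (a + 1)) + -j * cayleyCoeff j 0 * z ^ (j + 1) * G 0 := by
      have h1 := Finset.sum_range_succ
        (fun a : ℕ => -((j : ℝ) + a) * cayleyCoeff j a * z ^ (j + a + 1) * G a) (j + 1)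
      have h2 := Finset.sum_range_succ'
        (fun a : ℕ => -((j : ℝ) + a) * cayleyCoeff j a * z ^ (j + a + 1) * G a) (j + 1)
      rw [cayleyCoeff_of_lt (Nat.lt_succ_self j)] at h1
      rw [h1] at h2
      push_cast at h2
      simpa using h2
    rw [e1, add_right_comm, ← Finset.sum_add_distrib]
    congr 1
    refine Finset.sum_congr rfl fun a _ => ?_
    rw [cayleyCoeff]
    ring

lemma derivTower_cayleyTower {k : ℕ} {lam : ℝ} {ψ : ℝ → ℝ}
    (hψ : ContDiffOn ℝ (⊤ : ℕ∞) ψ (Ioi 0)) (hode : SolvesWaveODE (2 * k) lam ψ) :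
    DerivTower k (lam ^ 2) (cayleyTower ψ) := by
  refine DerivTower.of_hasDerivAt (fun j x hx => hasDerivAt_cayleyTower hψ j hx) fun x hx => ?_
  have hx1 : 1 - x ≠ 0 := by linarith [hx.2]
  obtain ⟨v, hv, rfl⟩ : ∃ v : ℝ, 0 < v ∧ x = (v - 1) / (v + 1) := by
    have hv : 0 < (1 + x) / (1 - x) := div_pos (by linarith [hx.1]) (by linarith [hx.2])
    refine ⟨_, hv, ?_⟩
    rw [eq_div_iff (by linarith)]
    field_simp
    ring
  have h := hode v hv
  rw [← iteratedDeriv_one, iteratedDeriv_eq_sum_cayleyTower hψ 1 hv,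
    iteratedDeriv_eq_sum_cayleyTower hψ 2 hv, ← cayleyTower_zero ψ hv] at h
  simp only [Finset.sum_range_succ, Finset.sum_range_zero, cayleyCoeff] at h
  have h1 : v + 1 ≠ 0 := by linarith
  rw [← h]
  rw [add_comm 1 v]
  push_cast
  field_simp
  ring

lemma tendsto_log_pow_mul_nhdsGT_zero {m : ℕ} (hm : m ≠ 0) :
    Tendsto (fun v : ℝ => Real.log v ^ m * v) (nhdsWithin 0 (Ioi 0)) (nhds 0) := by
  have hm' : (0 : ℝ) < m := by exact_mod_cast Nat.pos_of_ne_zero hm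
  have h := (tendsto_log_mul_rpow_nhdsGT_zero (one_div_pos.2 hm')).pow m
  rw [zero_pow hm] at h
  refine h.congr' ?_
  filter_upwards [self_mem_nhdsWithin] with v hv
  rw [mul_pow, ← Real.rpow_natCast (v ^ (1 / (m : ℝ))), ← Real.rpow_mul (le_of_lt hv),
    one_div_mul_cancel hm'.ne', Real.rpow_one]

/-- The limits at the endpoint `x = -1` of a derivative tower: values of the low derivatives, and
renormalized asymptotics of the `k`-th one. -/
structure EndpointData (k : ℕ) (F : ℕ → ℝ → ℝ) (l : ℕ → ℝ) (O h : ℝ) : Prop where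
  low : ∀ j < k, Tendsto (fun v => F j ((v - 1) / (v + 1))) (nhdsWithin 0 (Ioi 0)) (nhds (l j))
  id_mul_top : Tendsto (fun v => v * F k ((v - 1) / (v + 1))) (nhdsWithin 0 (Ioi 0)) (nhds 0)
  slope : Tendsto (fun v => 4 * v * (1 + v)⁻¹ ^ 2 * F (k + 1) ((v - 1) / (v + 1)))
    (nhdsWithin 0 (Ioi 0)) (nhds (O / 2 ^ k))
  intercept : Tendsto (fun v => F k ((v - 1) / (v + 1))
      - Real.log v / 2 * (4 * v * (1 + v)⁻¹ ^ 2 * F (k + 1) ((v - 1) / (v + 1))))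
    (nhdsWithin 0 (Ioi 0))
    (nhds ((h - ∑ a ∈ Finset.range k, cayleyCoeff k a * l a) / 2 ^ k))

lemma tendsto_inv_one_add_pow (m : ℕ) :
    Tendsto (fun v : ℝ => (1 + v)⁻¹ ^ m) (nhdsWithin 0 (Ioi 0)) (nhds 1) := by
  have h : ContinuousAt (fun v : ℝ => (1 + v)⁻¹ ^ m) 0 := by
    fun_prop (disch := norm_num)
  simpa using h.tendsto.mono_left nhdsWithin_le_nhds

lemma exists_tendsto_cayleyTower {k : ℕ} {ψ : ℝ → ℝ} (hψ : ContDiffOn ℝ (⊤ : ℕ∞) ψ (Ioi 0))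
    (hlow : ∀ a < k, ∃ L : ℝ,
      Tendsto (iteratedDeriv a ψ) (nhdsWithin 0 (Ioi 0)) (nhds L)) (j : ℕ) (hj : j < k) :
    ∃ L : ℝ, Tendsto (fun v => cayleyTower ψ j ((v - 1) / (v + 1)))
      (nhdsWithin 0 (Ioi 0)) (nhds L) := by
  induction j using Nat.strong_induction_on with
  | _ j ih =>
    obtain ⟨M, hM⟩ := hlow j hj
    choose! l hl using fun a (ha : a < j) => ih a ha (ha.trans hj)
    have hsum := tendsto_finsetSum (Finset.range j) fun a ha =>
      ((tendsto_inv_one_add_pow (j + a)).const_mul (cayleyCoeff j a)).mul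
        (hl a (Finset.mem_range.1 ha))
    have hz := (tendsto_inv_one_add_pow (j + j)).const_mul (2 ^ j : ℝ)
    refine ⟨_, ((hM.sub hsum).div hz (by simp)).congr' ?_⟩
    filter_upwards [self_mem_nhdsWithin] with v hv
    have hv' : (1 + v) ≠ 0 := by linarith [mem_Ioi.1 hv]
    simp only [Pi.div_apply]
    rw [iteratedDeriv_eq_sum_cayleyTower hψ j hv, Finset.sum_range_succ, cayleyCoeff_self,
      div_eq_iff (by positivity)]
    ring

lemma HasAsymptoticDataODE.exists_endpointData {k : ℕ} (hk : 2 ≤ k) {lam : ℝ} {ψ : ℝ → ℝ}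
    {φ₀ O h : ℝ} (H : HasAsymptoticDataODE (2 * k) lam ψ φ₀ O h) :
    ∃ l : ℕ → ℝ, l 0 = φ₀ ∧ EndpointData k (cayleyTower ψ) l O h := by
  obtain ⟨hcont, hψ, -, hlow, hφ₀, K, hK, hasy⟩ := H
  rw [show 2 * k / 2 = k by omega] at hlow hasy
  choose! l hl using exists_tendsto_cayleyTower (k := k) hψ fun a ha => hlow a (by omega)
  have hpos : ∀ᶠ v : ℝ in nhdsWithin 0 (Ioi 0), 0 < v := self_mem_nhdsWithin
  have hioc : ∀ᶠ v : ℝ in nhdsWithin 0 (Ioi 0), v ∈ Ioc (0 : ℝ) 1 :=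
    Ioc_mem_nhdsGT one_pos
  have hid : Tendsto (fun v : ℝ => v) (nhdsWithin 0 (Ioi 0)) (nhds 0) :=
    tendsto_id.mono_left nhdsWithin_le_nhds
  have hlog1 := tendsto_log_pow_mul_nhdsGT_zero (m := 1) one_ne_zero
  have hlog2 := tendsto_log_pow_mul_nhdsGT_zero (m := 2) two_ne_zero
  have hlog3 := tendsto_log_pow_mul_nhdsGT_zero (m := 3) three_ne_zero
  have hψk : Tendsto (fun v => iteratedDeriv k ψ v - 1 / 2 * O * Real.log v - h)
      (nhdsWithin 0 (Ioi 0)) (nhds 0) := by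
    refine squeeze_zero_norm' (a := fun v => K * (v + Real.log v ^ 2 * v)) ?_
      (by simpa using (hid.add hlog2).const_mul K)
    filter_upwards [hioc] with v hv
    rw [Real.norm_eq_abs]
    exact (hasy v hv).1.trans (le_of_eq (by ring))
  have hψk1 : Tendsto (fun v => v * iteratedDeriv (k + 1) ψ v - O / 2)
      (nhdsWithin 0 (Ioi 0)) (nhds 0) := by
    refine squeeze_zero_norm' (a := fun v => K * (v + Real.log v ^ 2 * v)) ?_
      (by simpa using (hid.add hlog2).const_mul K)
    filter_upwards [hioc] with v hv
    rw [Real.norm_eq_abs]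
    exact (hasy v hv).2.trans (le_of_eq (by ring))
  have hψk1log : Tendsto (fun v => Real.log v * (v * iteratedDeriv (k + 1) ψ v - O / 2))
      (nhdsWithin 0 (Ioi 0)) (nhds 0) := by
    refine squeeze_zero_norm'
      (a := fun v => K * (|Real.log v ^ 1 * v| + |Real.log v ^ 3 * v|)) ?_
      (by simpa using (hlog1.abs.add hlog3.abs).const_mul K)
    filter_upwards [hioc] with v hv
    rw [Real.norm_eq_abs, abs_mul, abs_mul, abs_mul, abs_of_pos hv.1, pow_one, abs_pow]
    calc |Real.log v| * |v * iteratedDeriv (k + 1) ψ v - O / 2|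
        ≤ |Real.log v| * (K * v * (1 + Real.log v ^ 2)) := by gcongr; exact (hasy v hv).2
      _ = _ := by rw [← sq_abs (Real.log v)]; ring
  have hlowsum : ∀ m, Tendsto (fun v => ∑ a ∈ Finset.range k, cayleyCoeff m a
        * (1 + v)⁻¹ ^ (m + a) * cayleyTower ψ a ((v - 1) / (v + 1))) (nhdsWithin 0 (Ioi 0))
      (nhds (∑ a ∈ Finset.range k, cayleyCoeff m a * l a)) := by
    intro m
    have := tendsto_finsetSum (Finset.range k) fun a ha =>
      ((tendsto_inv_one_add_pow (m + a)).const_mul (cayleyCoeff m a)).mul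
        (hl a (Finset.mem_range.1 ha))
    simpa using this
  have hz2k : ∀ m : ℕ, Tendsto (fun v : ℝ => (2 : ℝ) ^ m * (1 + v)⁻¹ ^ (m + m))
      (nhdsWithin 0 (Ioi 0)) (nhds (2 ^ m)) := fun m => by
    simpa using (tendsto_inv_one_add_pow (m + m)).const_mul ((2 : ℝ) ^ m)
  have hz2k0 : ∀ (m : ℕ) {v : ℝ}, 0 < v → (2 : ℝ) ^ m * (1 + v)⁻¹ ^ (m + m) ≠ 0 :=
    fun m v hv => by positivity
  have h2 : ∀ m : ℕ, (2 : ℝ) ^ m ≠ 0 := fun m => by positivity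
  have hexpk : ∀ v : ℝ, 0 < v → iteratedDeriv k ψ v = (∑ a ∈ Finset.range k, cayleyCoeff k a
        * (1 + v)⁻¹ ^ (k + a) * cayleyTower ψ a ((v - 1) / (v + 1)))
      + 2 ^ k * (1 + v)⁻¹ ^ (k + k) * cayleyTower ψ k ((v - 1) / (v + 1)) := fun v hv => by
    rw [iteratedDeriv_eq_sum_cayleyTower hψ k hv, Finset.sum_range_succ, cayleyCoeff_self]
  have hexpk1 : ∀ v : ℝ, 0 < v → iteratedDeriv (k + 1) ψ v
      = (∑ a ∈ Finset.range k, cayleyCoeff (k + 1) a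
        * (1 + v)⁻¹ ^ (k + 1 + a) * cayleyTower ψ a ((v - 1) / (v + 1)))
      + cayleyCoeff (k + 1) k * (1 + v)⁻¹ ^ (k + 1 + k) * cayleyTower ψ k ((v - 1) / (v + 1))
      + 2 ^ (k + 1) * (1 + v)⁻¹ ^ (k + 1 + (k + 1))
        * cayleyTower ψ (k + 1) ((v - 1) / (v + 1)) := fun v hv => by
    rw [iteratedDeriv_eq_sum_cayleyTower hψ (k + 1) hv, Finset.sum_range_succ,
      Finset.sum_range_succ, cayleyCoeff_self]
  have htop : ∀ w : ℝ → ℝ, Tendsto w (nhdsWithin 0 (Ioi 0)) (nhds 0) →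
      Tendsto (fun v => w v * Real.log v) (nhdsWithin 0 (Ioi 0)) (nhds 0) →
      Tendsto (fun v => w v * cayleyTower ψ k ((v - 1) / (v + 1)))
        (nhdsWithin 0 (Ioi 0)) (nhds 0) := by
    intro w hw hwlog
    have h1 := (((hw.mul hψk).add (hwlog.const_mul (1 / 2 * O))).add (hw.mul_const h)).sub
      (hw.mul (hlowsum k))
    have h3 := h1.div (hz2k k) (h2 k)
    simp only [zero_mul, mul_zero, add_zero, sub_zero, zero_div] at h3
    refine h3.congr' ?_
    filter_upwards [hpos] with v hv
    simp only [Pi.div_apply]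
    rw [div_eq_iff (hz2k0 k hv), hexpk v hv]
    ring
  have hvtop : Tendsto (fun v => v * cayleyTower ψ k ((v - 1) / (v + 1)))
      (nhdsWithin 0 (Ioi 0)) (nhds 0) :=
    htop _ hid (by simpa [mul_comm] using hlog1)
  have hvlogtop : Tendsto (fun v => v * Real.log v * cayleyTower ψ k ((v - 1) / (v + 1)))
      (nhdsWithin 0 (Ioi 0)) (nhds 0) := by
    refine htop _ (by simpa [mul_comm] using hlog1) (hlog2.congr fun v => ?_)
    ring
  have hvlog : Tendsto (fun v : ℝ => v * Real.log v) (nhdsWithin 0 (Ioi 0)) (nhds 0) := by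
    simpa [mul_comm] using hlog1
  have hcoef := (tendsto_inv_one_add_pow (k + 1 + k)).const_mul (cayleyCoeff (k + 1) k)
  refine ⟨l, ?_, hl, hvtop, ?_, ?_⟩
  · have h0 : Tendsto ψ (nhdsWithin 0 (Ioi 0)) (nhds (ψ 0)) :=
      (hcont 0 self_mem_Ici).mono_left (nhdsWithin_mono _ Ioi_subset_Ici_self)
    rw [← hφ₀]
    refine tendsto_nhds_unique ((hl 0 (by omega)).congr' ?_) h0
    filter_upwards [hpos] with v hv using cayleyTower_zero ψ hv
  · have h1 := (((hψk1.add_const (O / 2)).sub (hid.mul (hlowsum (k + 1)))).sub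
      (hcoef.mul hvtop)).mul (tendsto_inv_one_add_pow 2)
    have h3 := (h1.div (hz2k (k + 1)) (h2 (k + 1))).const_mul 4
    simp only [zero_mul, mul_zero, zero_add, sub_zero, mul_one] at h3
    rw [show 4 * (O / 2 / 2 ^ (k + 1)) = O / 2 ^ k by rw [pow_succ]; ring] at h3
    refine h3.congr' ?_
    filter_upwards [hpos] with v hv
    simp only [Pi.div_apply]
    rw [← mul_div_assoc, div_eq_iff (hz2k0 (k + 1) hv), hexpk1 v hv]
    ring
  · have h1 := (((hψk.add_const h).sub hψk1log).sub (hlowsum k)).add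
      ((hvlog.mul (hlowsum (k + 1))).add (hcoef.mul hvlogtop))
    have h3 := h1.div (hz2k k) (h2 k)
    simp only [zero_mul, mul_zero, zero_add, sub_zero, add_zero] at h3
    refine h3.congr' ?_
    filter_upwards [hpos] with v hv
    simp only [Pi.div_apply]
    rw [div_eq_iff (hz2k0 k hv), hexpk v hv, hexpk1 v hv]
    ring

lemma tendsto_cayley :
    Tendsto (fun v : ℝ => (v - 1) / (v + 1)) (nhdsWithin 0 (Ioi 0)) (nhds (-1)) := by
  have h : ContinuousAt (fun v : ℝ => (v - 1) / (v + 1)) 0 := by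
    fun_prop (disch := norm_num)
  simpa using h.tendsto.mono_left nhdsWithin_le_nhds

lemma one_sub_cayley_sq {v : ℝ} (hv : 0 < v) :
    1 - ((v - 1) / (v + 1)) ^ 2 = 4 * v * (1 + v)⁻¹ ^ 2 := by
  have h1 : v + 1 ≠ 0 := by linarith
  rw [add_comm 1 v]
  field_simp
  ring

lemma EndpointData.recursion {k : ℕ} {μ : ℝ} {F : ℕ → ℝ → ℝ} {l : ℕ → ℝ} {O h : ℝ}
    (hE : EndpointData k F l O h) (hF : DerivTower k μ F) {j : ℕ} (hj : j + 1 < k) :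
    (2 * k - 2 - 2 * j) * l (j + 1) = towerCoeff k μ j * l j := by
  have htop : Tendsto (fun v => v * F (j + 2) ((v - 1) / (v + 1))) (nhdsWithin 0 (Ioi 0))
      (nhds 0) := by
    rcases (show j + 2 ≤ k from hj).lt_or_eq with h2 | h2
    · simpa using (tendsto_id.mono_left nhdsWithin_le_nhds).mul (hE.low (j + 2) h2)
    · rw [h2]; exact hE.id_mul_top
  have h1 := ((((tendsto_inv_one_add_pow 2).const_mul 4).mul htop).add
    ((tendsto_cayley.const_mul (2 * (k : ℝ) - 2 - 2 * j)).mul (hE.low (j + 1) hj))).add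
    ((hE.low j (by omega)).const_mul (towerCoeff k μ j))
  have h2 := tendsto_nhds_unique (h1.congr' (f₂ := fun _ => (0 : ℝ)) ?_) tendsto_const_nhds
  · linear_combination -h2
  · filter_upwards [self_mem_nhdsWithin] with v hv
    rw [← hF.ode j _ (cayley_mem hv), one_sub_cayley_sq hv]
    ring

lemma EndpointData.recursion_last {k : ℕ} {μ : ℝ} {F : ℕ → ℝ → ℝ} {l : ℕ → ℝ} {O h : ℝ}
    (hE : EndpointData (k + 1) F l O h) (hF : DerivTower (k + 1) μ F) :
    O / 2 ^ (k + 1) = -(towerCoeff (k + 1) μ k * l k) := by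
  have h1 := hE.slope.add ((hE.low k k.lt_succ_self).const_mul (towerCoeff (k + 1) μ k))
  have h2 := tendsto_nhds_unique (h1.congr' (f₂ := fun _ => (0 : ℝ)) ?_) tendsto_const_nhds
  · linear_combination h2
  · filter_upwards [self_mem_nhdsWithin] with v hv
    have := hF.ode k _ (cayley_mem hv)
    rw [one_sub_cayley_sq hv] at this
    rw [← this]
    push_cast
    ring

lemma towerCoeff_le {k j : ℕ} (hj : j < k) {μ : ℝ} (hμ : 0 ≤ μ) :
    towerCoeff k μ j ≤ 2 * k ^ 2 * (1 + μ) := by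
  have h1 : (j : ℝ) + 1 ≤ k := by exact_mod_cast hj
  have h2 : (0 : ℝ) ≤ j := j.cast_nonneg
  rw [towerCoeff]
  nlinarith [mul_nonneg h2 h2, mul_nonneg (sub_nonneg.2 h1) h2,
    mul_nonneg hμ (sub_nonneg.2 (show (1 : ℝ) ≤ 2 * k ^ 2 by nlinarith))]

lemma le_towerCoeff {k j : ℕ} (hj : j < k) (μ : ℝ) : μ ≤ towerCoeff k μ j := by
  have h1 : (j : ℝ) + 1 ≤ k := by exact_mod_cast hj
  have h2 : (0 : ℝ) ≤ j := j.cast_nonneg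
  rw [towerCoeff]
  nlinarith

lemma EndpointData.abs_low_le {k : ℕ} {μ : ℝ} (hμ : 0 ≤ μ) {F : ℕ → ℝ → ℝ} {l : ℕ → ℝ}
    {O h : ℝ} (hE : EndpointData k F l O h) (hF : DerivTower k μ F) {j : ℕ} (hj : j < k) :
    |l j| ≤ (2 * k ^ 2 * (1 + μ)) ^ j * |l 0| := by
  induction j with
  | zero => simp
  | succ j ih =>
    have h1 := congrArg abs (hE.recursion hF hj)
    have hjk : (j : ℝ) + 2 ≤ k := by exact_mod_cast hj
    have hc := le_towerCoeff (show j < k by omega) μ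
    rw [abs_mul, abs_mul, abs_of_nonneg (hμ.trans hc),
      abs_of_pos (show (0 : ℝ) < 2 * k - 2 - 2 * j by linarith)] at h1
    calc |l (j + 1)| ≤ (2 * k - 2 - 2 * j) * |l (j + 1)| :=
          le_mul_of_one_le_left (abs_nonneg _) (by linarith)
      _ = towerCoeff k μ j * |l j| := h1
      _ ≤ (2 * k ^ 2 * (1 + μ)) * ((2 * k ^ 2 * (1 + μ)) ^ j * |l 0|) := by
          gcongr
          · exact towerCoeff_le (by omega) hμ
          · exact ih (by omega)
      _ = _ := by ring

lemma EndpointData.abs_slope_le {k : ℕ} (hk : 2 ≤ k) {μ : ℝ} (hμ : 0 ≤ μ) {F : ℕ → ℝ → ℝ}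
    {l : ℕ → ℝ} {O h : ℝ} (hE : EndpointData k F l O h) (hF : DerivTower k μ F) :
    |O / 2 ^ k| ≤ (2 * k ^ 2 * (1 + μ)) ^ k * |l 0| := by
  obtain ⟨k, rfl⟩ : ∃ m, k = m + 1 := ⟨k - 1, by omega⟩
  have hc := le_towerCoeff (Nat.lt_succ_self k) μ
  rw [hE.recursion_last hF, abs_neg, abs_mul, abs_of_nonneg (hμ.trans hc), pow_succ', mul_assoc]
  gcongr
  · exact towerCoeff_le (by omega) hμ
  · exact hE.abs_low_le hμ hF (by omega)

lemma EndpointData.le_abs_low {k : ℕ} {μ : ℝ} (hμ : 1 ≤ μ) {F : ℕ → ℝ → ℝ} {l : ℕ → ℝ}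
    {O h : ℝ} (hE : EndpointData k F l O h) (hF : DerivTower k μ F) {j : ℕ} (hj : j < k) :
    ((1 + μ) / (4 * k)) ^ j * |l 0| ≤ |l j| := by
  induction j with
  | zero => simp
  | succ j ih =>
    have h1 := congrArg abs (hE.recursion hF hj)
    have hjk : (j : ℝ) + 2 ≤ k := by exact_mod_cast hj
    have hj0 : (0 : ℝ) ≤ j := j.cast_nonneg
    have hc := le_towerCoeff (show j < k by omega) μ
    have hk0 : (0 : ℝ) < k := by linarith
    rw [abs_mul, abs_mul, abs_of_nonneg (by linarith),
      abs_of_pos (show (0 : ℝ) < towerCoeff k μ j by linarith)] at h1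
    have h2 : (1 + μ) / 2 * |l j| ≤ 2 * k * |l (j + 1)| :=
      calc (1 + μ) / 2 * |l j| ≤ towerCoeff k μ j * |l j| := by gcongr; linarith
        _ = (2 * k - 2 - 2 * j) * |l (j + 1)| := h1.symm
        _ ≤ 2 * k * |l (j + 1)| := by gcongr; linarith
    calc ((1 + μ) / (4 * k)) ^ (j + 1) * |l 0|
        = (1 + μ) / (4 * k) * (((1 + μ) / (4 * k)) ^ j * |l 0|) := by ring
      _ ≤ (1 + μ) / (4 * k) * |l j| := by gcongr; exact ih (by omega)
      _ = (1 + μ) / 2 * |l j| / (2 * k) := by field_simp; ring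
      _ ≤ |l (j + 1)| := by rw [div_le_iff₀ (by positivity)]; linarith

lemma EndpointData.le_abs_slope {k : ℕ} (hk : 2 ≤ k) {μ : ℝ} (hμ : 1 ≤ μ) {F : ℕ → ℝ → ℝ}
    {l : ℕ → ℝ} {O h : ℝ} (hE : EndpointData k F l O h) (hF : DerivTower k μ F) :
    ((1 + μ) / (4 * k)) ^ k * |l 0| ≤ |O / 2 ^ k| := by
  obtain ⟨k, rfl⟩ : ∃ m, k = m + 1 := ⟨k - 1, by omega⟩
  have hc := le_towerCoeff (Nat.lt_succ_self k) μ
  have hk1 : (2 : ℝ) ≤ (k + 1 : ℕ) := by exact_mod_cast hk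
  rw [hE.recursion_last hF, abs_neg, abs_mul,
    abs_of_pos (show 0 < towerCoeff (k + 1) μ k from zero_lt_one.trans_le (hμ.trans hc)),
    pow_succ', mul_assoc]
  refine mul_le_mul (le_trans ?_ hc) (hE.le_abs_low hμ hF (by omega)) (by positivity)
    (by linarith)
  rw [div_le_iff₀ (by linarith)]
  nlinarith

lemma sq_sub_sub_le (a b c : ℝ) : (a - b - c) ^ 2 ≤ 3 * (a ^ 2 + b ^ 2 + c ^ 2) := by
  linarith [sq_nonneg (a + b), sq_nonneg (a + c), sq_nonneg (b - c)]

/-- The renormalized endpoint data `(h - O log √(1 + μ), (1 + μ) ^ k φ₀)` are comparable with the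
limits `O / 2 ^ k` and `β` of the associated first-order system, up to constants depending on `k`
only. -/
lemma exists_endpoint_estimates {k : ℕ} (hk : 2 ≤ k) :
    ∃ C : ℝ, 0 < C ∧ ∀ {μ : ℝ} {F : ℕ → ℝ → ℝ} {l : ℕ → ℝ} {O h β : ℝ}, 0 ≤ μ →
      DerivTower k μ F → EndpointData k F l O h →
      β = (h - ∑ a ∈ Finset.range k, cayleyCoeff k a * l a) / 2 ^ k
        - Real.log (μ + k * (k - 1)) / 2 * (O / 2 ^ k) →
      (O / 2 ^ k) ^ 2 + β ^ 2
        ≤ C * ((h - O * Real.log (Real.sqrt (1 + μ))) ^ 2 + (1 + μ) ^ (2 * k) * l 0 ^ 2) ∧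
      (h - O * Real.log (Real.sqrt (1 + μ))) ^ 2
        ≤ C * ((O / 2 ^ k) ^ 2 + β ^ 2 + (1 + μ) ^ (2 * k) * l 0 ^ 2) ∧
      (1 ≤ μ → (1 + μ) ^ (2 * k) * l 0 ^ 2 ≤ C * (O / 2 ^ k) ^ 2) := by
  set A : ℝ := ∑ a ∈ Finset.range k, |cayleyCoeff k a| * (2 * k ^ 2) ^ a with hA
  set D : ℝ := ((2 * k ^ 2) ^ k) ^ 2 with hD
  have hk2 : (2 : ℝ) ≤ k := by exact_mod_cast hk
  have hA0 : 0 ≤ A := Finset.sum_nonneg fun a _ => by positivity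
  refine ⟨1 + D + 3 + 3 * A ^ 2 + 3 * (k * 2 ^ k) ^ 2 * (1 + D) + 3 * (2 ^ k) ^ 2
    + ((4 * k) ^ k) ^ 2, by positivity, ?_⟩
  intro μ F l O h β hμ hF hE hβ
  set P : ℝ := (1 + μ) ^ k * |l 0| with hP
  have hP0 : 0 ≤ P := by positivity
  have hP2 : (1 + μ) ^ (2 * k) * l 0 ^ 2 = P ^ 2 := by
    rw [hP, mul_pow, sq_abs, ← pow_mul, mul_comm 2 k]
  set α := O / 2 ^ k with hα
  set H := h - O * Real.log (Real.sqrt (1 + μ)) with hH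
  set S := ∑ a ∈ Finset.range k, cayleyCoeff k a * l a with hS
  have h2k : (0 : ℝ) < 2 ^ k := by positivity
  have h2k1 : (1 : ℝ) ≤ 2 ^ k := one_le_pow₀ (by norm_num)
  have hSle : S ^ 2 ≤ A ^ 2 * P ^ 2 := by
    rw [← mul_pow, ← sq_abs S, hA, hP, Finset.sum_mul]
    gcongr
    refine (Finset.abs_sum_le_sum_abs _ _).trans (Finset.sum_le_sum fun a ha => ?_)
    have hak := Finset.mem_range.1 ha
    rw [abs_mul, mul_assoc]
    gcongr
    refine (hE.abs_low_le hμ hF hak).trans ?_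
    rw [mul_pow, mul_assoc]
    gcongr
    linarith
  have hα2 : α ^ 2 ≤ D * P ^ 2 := by
    rw [← sq_abs, hD, ← mul_pow]
    gcongr
    refine (hE.abs_slope_le hk hμ hF).trans (le_of_eq ?_)
    rw [hP, mul_pow _ (1 + μ)]; ring
  set Λ : ℝ := μ + k * (k - 1) with hΛ
  have hΛ1 : 1 + μ ≤ Λ := by nlinarith
  have hΛ2 : Λ ≤ (k : ℝ) ^ 2 * (1 + μ) := by nlinarith
  set δ : ℝ := Real.log Λ / 2 - Real.log (Real.sqrt (1 + μ)) with hδ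
  have hδ2 : δ ^ 2 ≤ (k : ℝ) ^ 2 := by
    have e1 := Real.log_le_log (by linarith) hΛ1
    have e2 := Real.log_le_log (by linarith) hΛ2
    rw [Real.log_mul (by positivity) (by positivity), Real.log_pow] at e2
    have e3 := Real.log_le_sub_one_of_pos (show (0 : ℝ) < k by linarith)
    rw [hδ, Real.log_sqrt (by linarith)]
    push_cast at e2
    refine sq_le_sq' ?_ ?_ <;> linarith
  have hrel : 2 ^ k * β = H - S - δ * (2 ^ k * α) := by
    rw [hβ, hδ, hH, hα]
    field_simp
    ring
  have hδα : (δ * (2 ^ k * α)) ^ 2 ≤ (k * 2 ^ k) ^ 2 * α ^ 2 := by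
    rw [mul_pow, mul_pow, mul_pow, mul_assoc]
    gcongr
  have hD0 : 0 ≤ D := by positivity
  rw [hP2]
  have hz2 : (2 ^ k * β) ^ 2 ≤ 3 * (H ^ 2 + S ^ 2 + (δ * (2 ^ k * α)) ^ 2) := by
    rw [hrel]
    exact sq_sub_sub_le _ _ _
  have hH2 : H ^ 2 ≤ 3 * ((2 ^ k * β) ^ 2 + S ^ 2 + (δ * (2 ^ k * α)) ^ 2) := by
    have := sq_sub_sub_le (2 ^ k * β) (-S) (-(δ * (2 ^ k * α)))
    rw [show 2 ^ k * β - -S - -(δ * (2 ^ k * α)) = H by rw [hrel]; ring, neg_sq, neg_sq] at this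
    exact this
  have hβ2 : β ^ 2 ≤ (2 ^ k * β) ^ 2 := by
    rw [mul_pow]
    exact le_mul_of_one_le_left (sq_nonneg _) (one_le_pow₀ h2k1)
  have hR : 1 ≤ μ → P ^ 2 ≤ ((4 * k) ^ k) ^ 2 * α ^ 2 := by
    intro hμ1
    rw [← mul_pow, ← sq_abs (_ * α), abs_mul, abs_of_pos (show (0 : ℝ) < (4 * k) ^ k by positivity)]
    gcongr
    have h1 := hE.le_abs_slope hk hμ1 hF
    rw [div_pow, div_mul_eq_mul_div, div_le_iff₀ (by positivity)] at h1
    rw [mul_comm]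
    exact h1
  have hMα := mul_le_mul_of_nonneg_left hα2 (sq_nonneg ((k : ℝ) * 2 ^ k))
  rw [mul_pow (2 ^ k) β] at hH2
  have ha := sq_nonneg α
  have hb := sq_nonneg β
  have hp := sq_nonneg P
  have hH0 := sq_nonneg H
  have hA2 := sq_nonneg A
  have hM2 := sq_nonneg ((k : ℝ) * 2 ^ k)
  have hN2 := sq_nonneg ((2 : ℝ) ^ k)
  have hR2 := sq_nonneg ((4 * (k : ℝ)) ^ k)
  generalize ((k : ℝ) * 2 ^ k) ^ 2 = M2 at *
  generalize ((4 * (k : ℝ)) ^ k) ^ 2 = R2 at *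
  generalize ((2 : ℝ) ^ k) ^ 2 = N2 at *
  generalize A ^ 2 = A2 at *
  have hMD := mul_nonneg hM2 hD0
  refine ⟨?_, ?_, fun hμ1 => (hR hμ1).trans ?_⟩
  · calc α ^ 2 + β ^ 2 ≤ 3 * H ^ 2 + (D + 3 * A2 + 3 * M2 * D) * P ^ 2 := by linarith
      _ ≤ (1 + D + 3 + 3 * A2 + 3 * M2 * (1 + D) + 3 * N2 + R2) * H ^ 2
        + (1 + D + 3 + 3 * A2 + 3 * M2 * (1 + D) + 3 * N2 + R2) * P ^ 2 :=
          add_le_add (mul_le_mul_of_nonneg_right (by linarith) hH0)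
            (mul_le_mul_of_nonneg_right (by linarith) hp)
      _ = _ := by ring
  · calc H ^ 2 ≤ 3 * M2 * α ^ 2 + 3 * N2 * β ^ 2 + 3 * A2 * P ^ 2 := by linarith
      _ ≤ (1 + D + 3 + 3 * A2 + 3 * M2 * (1 + D) + 3 * N2 + R2) * α ^ 2
        + (1 + D + 3 + 3 * A2 + 3 * M2 * (1 + D) + 3 * N2 + R2) * β ^ 2
        + (1 + D + 3 + 3 * A2 + 3 * M2 * (1 + D) + 3 * N2 + R2) * P ^ 2 :=
          add_le_add (add_le_add (mul_le_mul_of_nonneg_right (by linarith) ha)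
            (mul_le_mul_of_nonneg_right (by linarith) hb))
            (mul_le_mul_of_nonneg_right (by linarith) hp)
      _ = _ := by ring
  · gcongr
    linarith

lemma tanh_eq_cayley (τ : ℝ) :
    Real.tanh τ = (Real.exp (2 * τ) - 1) / (Real.exp (2 * τ) + 1) := by
  rw [Real.tanh_eq_sinh_div_cosh, Real.sinh_eq, Real.cosh_eq, two_mul, Real.exp_add, Real.exp_neg]
  have := Real.exp_pos τ
  field_simp

lemma inv_cosh_sq_eq (τ : ℝ) :
    1 / Real.cosh τ ^ 2 = 4 * Real.exp (2 * τ) * (1 + Real.exp (2 * τ))⁻¹ ^ 2 := by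
  rw [← one_sub_tanh_sq, tanh_eq_cayley, one_sub_cayley_sq (Real.exp_pos _)]

lemma tendsto_exp_two_mul_atBot :
    Tendsto (fun τ : ℝ => Real.exp (2 * τ)) atBot (nhdsWithin 0 (Ioi 0)) := by
  refine tendsto_nhdsWithin_iff.2 ⟨?_, Eventually.of_forall fun τ => Real.exp_pos _⟩
  exact Real.tendsto_exp_atBot.comp (tendsto_id.const_mul_atBot two_pos)

lemma EndpointData.tendsto_slope {k : ℕ} {F : ℕ → ℝ → ℝ} {l : ℕ → ℝ} {O h : ℝ}
    (hE : EndpointData k F l O h) :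
    Tendsto (fun τ => F (k + 1) (Real.tanh τ) / Real.cosh τ ^ 2) atBot (nhds (O / 2 ^ k)) := by
  refine (hE.slope.comp tendsto_exp_two_mul_atBot).congr fun τ => ?_
  rw [Function.comp_apply, ← inv_cosh_sq_eq, ← tanh_eq_cayley]
  ring

lemma EndpointData.tendsto_intercept {k : ℕ} {F : ℕ → ℝ → ℝ} {l : ℕ → ℝ} {O h : ℝ}
    (hE : EndpointData k F l O h) (τ₀ : ℝ) :
    Tendsto (fun τ => F k (Real.tanh τ) - (τ - τ₀) * (F (k + 1) (Real.tanh τ) / Real.cosh τ ^ 2))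
      atBot (nhds ((h - ∑ a ∈ Finset.range k, cayleyCoeff k a * l a) / 2 ^ k
        + τ₀ * (O / 2 ^ k))) := by
  refine ((hE.intercept.comp tendsto_exp_two_mul_atBot).add
    (hE.tendsto_slope.const_mul τ₀)).congr fun τ => ?_
  rw [Function.comp_apply, ← inv_cosh_sq_eq, ← tanh_eq_cayley, Real.log_exp]
  ring

lemma cayleyTower_reflect {ψ ψ' : ℝ → ℝ} (h : ∀ v > 0, ψ' v = ψ v⁻¹) (j : ℕ) {x : ℝ}
    (hx : x ∈ Ioo (-1 : ℝ) 1) : cayleyTower ψ' j x = (-1) ^ j * cayleyTower ψ j (-x) := by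
  rw [cayleyTower, cayleyTower, ← smul_eq_mul, ← iteratedDeriv_comp_neg]
  refine Filter.EventuallyEq.iteratedDeriv_eq j ?_
  filter_upwards [isOpen_Ioo.mem_nhds hx] with y hy
  rw [h _ (div_pos (by linarith [hy.1]) (by linarith [hy.2])), inv_div, sub_neg_eq_add,
    ← sub_eq_add_neg]

/-- Comparison of the endpoint data at `x = -1` of a derivative tower and of its reflection, that is
of the data at the two endpoints. -/
lemma DerivTower.scattering_bound {k : ℕ} (hk : 2 ≤ k) {μ : ℝ} (hμ : 0 ≤ μ) {F F' : ℕ → ℝ → ℝ}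
    {l l' : ℕ → ℝ} {O h O' h' τ₀ α β α' β' : ℝ} (hF : DerivTower k μ F)
    (hF' : ∀ j, ∀ x ∈ Ioo (-1 : ℝ) 1, F' j x = (-1) ^ j * F j (-x))
    (hE : EndpointData k F l O h) (hE' : EndpointData k F' l' O' h')
    (hτ₀ : τ₀ = -(Real.log (μ + k * (k - 1)) / 2))
    (hα : α = O / 2 ^ k)
    (hβ : β = (h - ∑ a ∈ Finset.range k, cayleyCoeff k a * l a) / 2 ^ k + τ₀ * (O / 2 ^ k))
    (hα' : α' = O' / 2 ^ k)
    (hβ' : β' = (h' - ∑ a ∈ Finset.range k, cayleyCoeff k a * l' a) / 2 ^ k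
      + τ₀ * (O' / 2 ^ k)) :
    α' ^ 2 + β' ^ 2 ≤ 72 * Real.exp 32 * (α ^ 2 + β ^ 2) ∧
    l' 0 ^ 2 ≤ 2 * l 0 ^ 2
      + 96 * (μ + k * (k - 1)) * Real.exp 16 * (α ^ 2 + β ^ 2) := by
  have hk2 : (2 : ℝ) ≤ k := by exact_mod_cast hk
  have hΛ : 1 ≤ μ + k * (k - 1) := by nlinarith
  have htanh : ∀ τ, Real.tanh τ ∈ Ioo (-1 : ℝ) 1 := fun τ => by
    rw [tanh_eq_cayley]; exact cayley_mem (Real.exp_pos _)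
  have hs : ((-1 : ℝ) ^ k) ^ 2 = 1 := by rw [← pow_mul, mul_comm, pow_mul]; simp
  have key := hF.sechSystem.scattering_bound hΛ (τ₀ := τ₀) (α := α) (β := β)
    (α' := (-1) ^ k * α') (β' := (-1) ^ k * β')
    (by rw [hτ₀, mul_neg, mul_div_cancel₀ _ two_ne_zero, Real.exp_neg, Real.exp_log (by linarith)]
        exact mul_inv_cancel₀ (by linarith))
    (hα ▸ hE.tendsto_slope) (hβ ▸ hE.tendsto_intercept τ₀)
    (by
      refine (hα' ▸ hE'.tendsto_slope.const_mul ((-1) ^ k)).congr fun τ => ?_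
      rw [hF' _ _ (htanh τ), Real.tanh_neg, Real.cosh_neg, pow_succ]
      linear_combination (-(F (k + 1) (-Real.tanh τ) / Real.cosh τ ^ 2)) * hs)
    (by
      refine (hβ' ▸ (hE'.tendsto_intercept τ₀).const_mul ((-1) ^ k)).congr fun τ => ?_
      rw [hF' _ _ (htanh τ), hF' _ _ (htanh τ), Real.tanh_neg, Real.cosh_neg, pow_succ]
      linear_combination (F k (-Real.tanh τ)
        + (τ - τ₀) * (F (k + 1) (-Real.tanh τ) / Real.cosh τ ^ 2)) * hs)
  rw [mul_pow, mul_pow, hs, one_mul, one_mul] at key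
  refine ⟨key.2, ?_⟩
  have hk1 := key.1
  rw [Real.tanh_zero, Real.cosh_zero, one_pow, div_one] at hk1
  have hl := hE.low 0 (by omega)
  have hl' := hE'.low 0 (by omega)
  have hd : (l' 0 - l 0) ^ 2 ≤ 8 * (F (k + 1) 0 ^ 2 + F k 0 ^ 2) := by
    refine le_of_tendsto ((hl'.sub hl).pow 2) ?_
    filter_upwards [self_mem_nhdsWithin] with v hv
    have hx := cayley_mem hv
    rw [hF' _ _ hx, pow_zero, one_mul]
    exact hF.sq_sub_le hk hμ hx ⟨by linarith [hx.2], by linarith [hx.1]⟩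
  nlinarith [sq_nonneg (l' 0 - 2 * l 0)]

/-- Boundedness of the scattering map (single-mode version of Theorems 1.1 and
4.6 of the paper). -/
theorem scattering_map_bounded (n : ℕ) (hn : Even n) (hn4 : 4 ≤ n) :
    ∃ C > 0, ∀ lam : ℝ, 0 ≤ lam → ∀ φ : ℝ → ℝ → ℝ,
      ContDiffOn ℝ (⊤ : ℕ∞) (fun p : ℝ × ℝ => φ p.1 p.2) {p : ℝ × ℝ | p.1 < 0 ∧ 0 < p.2} →
      SelfSimilar φ → SolvesDNWave n lam φ →
      ∀ ψ ψ' : ℝ → ℝ, ∀ φ₀ O h φ₀' O' h' : ℝ,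
      (∀ v > (0:ℝ), ψ v = φ (-1) v) →
      (∀ v > (0:ℝ), ψ' v = φ (-v) 1) →
      HasAsymptoticDataODE n lam ψ φ₀ O h →
      HasAsymptoticDataODE n lam ψ' φ₀' O' h' →
      (h' - O' * Real.log (Real.sqrt (1 + lam ^ 2))) ^ 2 + (1 + lam ^ 2) ^ n * φ₀' ^ 2
        ≤ C * ((h - O * Real.log (Real.sqrt (1 + lam ^ 2))) ^ 2
            + (1 + lam ^ 2) ^ n * φ₀ ^ 2) := by
  obtain ⟨k, rfl⟩ : ∃ k, n = 2 * k := hn.two_dvd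
  have hk : 2 ≤ k := by omega
  have hk2 : (2 : ℝ) ≤ k := by exact_mod_cast hk
  obtain ⟨C, hC, hest⟩ := exists_endpoint_estimates hk
  set T : ℝ := 72 * Real.exp 32 * C with hT
  set M : ℝ := 4 ^ k * (2 + 96 * (2 * (k : ℝ) ^ 2) * Real.exp 16 * C) with hM
  refine ⟨(2 * C + C ^ 2) * T + (C * T + (C + 1) * M), by positivity, ?_⟩
  intro lam _ φ _ hself _ ψ ψ' φ₀ O h φ₀' O' h' hψ hψ' H H'
  have hμ : 0 ≤ lam ^ 2 := sq_nonneg lam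
  have hrefl : ∀ v > 0, ψ' v = ψ v⁻¹ := fun v hv => by
    have hinv : 0 < v⁻¹ := inv_pos.2 hv
    have h1 := hself v hv (-1) (by norm_num) v⁻¹ hinv
    rw [hψ' v hv, hψ _ hinv, ← h1, mul_inv_cancel₀ hv.ne', mul_neg_one]
  have hF := derivTower_cayleyTower H.2.1 H.2.2.1
  have hF' := derivTower_cayleyTower H'.2.1 H'.2.2.1
  obtain ⟨l, rfl, hE⟩ := H.exists_endpointData hk
  obtain ⟨l', rfl, hE'⟩ := H'.exists_endpointData hk
  have hscat := hF.scattering_bound hk hμ (fun j x hx => cayleyTower_reflect hrefl j hx) hE hE'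
    rfl rfl rfl rfl rfl
  obtain ⟨hdata, -, -⟩ := hest hμ hF hE (by rw [sub_eq_add_neg, ← neg_mul])
  obtain ⟨-, hlog', hlow'⟩ := hest hμ hF' hE' (by rw [sub_eq_add_neg, ← neg_mul])
  generalize (h - ∑ a ∈ Finset.range k, cayleyCoeff k a * l a) / 2 ^ k
    + -(Real.log (lam ^ 2 + k * (k - 1)) / 2) * (O / 2 ^ k) = β at *
  generalize (h' - ∑ a ∈ Finset.range k, cayleyCoeff k a * l' a) / 2 ^ k
    + -(Real.log (lam ^ 2 + k * (k - 1)) / 2) * (O' / 2 ^ k) = β' at *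
  obtain ⟨hs1, hs2⟩ := hscat
  set S := (h - O * Real.log (Real.sqrt (1 + lam ^ 2))) ^ 2
    + (1 + lam ^ 2) ^ (2 * k) * l 0 ^ 2 with hS
  have hS0 : 0 ≤ S := by positivity
  have hT0 : 0 ≤ T := by positivity
  have hM0 : 0 ≤ M := by positivity
  have hE1 : (O' / 2 ^ k) ^ 2 + β' ^ 2 ≤ T * S :=
    calc _ ≤ 72 * Real.exp 32 * ((O / 2 ^ k) ^ 2 + β ^ 2) := hs1
      _ ≤ 72 * Real.exp 32 * (C * S) := by gcongr
      _ = T * S := by rw [hT]; ring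
  set E := (O' / 2 ^ k) ^ 2 + β' ^ 2 with hEdef
  set p := (1 + lam ^ 2) ^ (2 * k) * l' 0 ^ 2 with hp
  have hTS : 0 ≤ T * S := mul_nonneg hT0 hS0
  have hMS : 0 ≤ M * S := mul_nonneg hM0 hS0
  rcases le_total 1 (lam ^ 2) with hμ1 | hμ1
  · have hp' : p ≤ C * (T * S) :=
      calc p ≤ C * (O' / 2 ^ k) ^ 2 := hlow' hμ1
        _ ≤ C * E := by gcongr; rw [hEdef]; linarith [sq_nonneg β']
        _ ≤ C * (T * S) := by gcongr
    have hh' := hlog'.trans (mul_le_mul_of_nonneg_left (add_le_add hE1 hp') hC.le)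
    have h1 : 0 ≤ C * (T * S) := by positivity
    have h2 : 0 ≤ (C + 1) * (M * S) := by positivity
    linarith
  · have hl0 : l 0 ^ 2 ≤ S := by
      have : l 0 ^ 2 ≤ (1 + lam ^ 2) ^ (2 * k) * l 0 ^ 2 :=
        le_mul_of_one_le_left (sq_nonneg _) (one_le_pow₀ (by linarith))
      rw [hS]
      linarith [sq_nonneg (h - O * Real.log (Real.sqrt (1 + lam ^ 2)))]
    have hp' : p ≤ M * S :=
      calc p ≤ (1 + 1) ^ (2 * k) * (2 * l 0 ^ 2
            + 96 * (lam ^ 2 + k * (k - 1)) * Real.exp 16 * ((O / 2 ^ k) ^ 2 + β ^ 2)) := by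
            rw [hp]; gcongr
        _ ≤ (1 + 1) ^ (2 * k) * (2 * S + 96 * (2 * (k : ℝ) ^ 2) * Real.exp 16 * (C * S)) := by
            gcongr
            nlinarith
        _ = M * S := by rw [hM, pow_mul]; norm_num; ring
    have hh' := hlog'.trans (mul_le_mul_of_nonneg_left (add_le_add hE1 hp') hC.le)
    have h1 : 0 ≤ (2 * C + C ^ 2) * (T * S) := by positivity
    linarith
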